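/- arXiv:1803.09182 — 11 statements merged into one kernel-verified Lean document; each statement's English description precedes it below -/
import Mathlib

section
/- There exist an open neighborhood Ω of 0 in ℝ² and smooth functions X₁₁, b, c : Ω → ℝ such that: Δb + X₁₁ · ∂_y b = 0 and Δc + ∂_x b = 0 on Ω (with Δ = −(∂_x² + ∂_y²)); c vanishes to infinite order at 0; and c is not identically zero on Ω. Consequently F = [[1, b],[0, c]] is a smooth solution of the elliptic system ΔF + XF = 0 with X = [[X₁₁∂_y, 0],[∂_x, 0]], while det F = c vanishes to infinite order at 0 without vanishing identically, so the strong unique continuation property fails for determinants of solutions of such non-diagonal second-order elliptic systems. -/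
open MeasureTheory

/-- Partial derivative in the `x` direction on `ℝ × ℝ`. -/
noncomputable def pdx (f : ℝ × ℝ → ℝ) (p : ℝ × ℝ) : ℝ := fderiv ℝ f p (1, 0)

/-- Partial derivative in the `y` direction on `ℝ × ℝ`. -/
noncomputable def pdy (f : ℝ × ℝ → ℝ) (p : ℝ × ℝ) : ℝ := fderiv ℝ f p (0, 1)

/-- The Laplacian with the sign convention `Δ = −(∂_x² + ∂_y²)`. -/
noncomputable def lap (f : ℝ × ℝ → ℝ) (p : ℝ × ℝ) : ℝ := -(pdx (pdx f) p + pdy (pdy f) p)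

theorem pdx_comp_fst {g : ℝ → ℝ} (hg : Differentiable ℝ g) :
    pdx (fun p => g p.1) = fun p => deriv g p.1 := by
  funext p
  have h := (hg p.1).hasDerivAt.comp_hasFDerivAt p (hasFDerivAt_fst (𝕜 := ℝ))
  have h' : fderiv ℝ (fun p : ℝ × ℝ => g p.1) p = _ := h.fderiv
  simp [pdx, h']

theorem pdy_comp_fst {g : ℝ → ℝ} (hg : Differentiable ℝ g) :
    pdy (fun p => g p.1) = fun _ => 0 := by
  funext p
  have h := (hg p.1).hasDerivAt.comp_hasFDerivAt p (hasFDerivAt_fst (𝕜 := ℝ))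
  have h' : fderiv ℝ (fun p : ℝ × ℝ => g p.1) p = _ := h.fderiv
  simp [pdy, h']

theorem pdx_snd_add_comp_fst {g : ℝ → ℝ} (hg : Differentiable ℝ g) :
    pdx (fun p => p.2 + g p.1) = fun p => deriv g p.1 := by
  funext p
  have h := (hasFDerivAt_snd (𝕜 := ℝ)).add
    ((hg p.1).hasDerivAt.comp_hasFDerivAt p (hasFDerivAt_fst (𝕜 := ℝ)))
  have h' : fderiv ℝ (fun p : ℝ × ℝ => p.2 + g p.1) p = _ := h.fderiv
  simp [pdx, h']

theorem pdy_snd_add_comp_fst {g : ℝ → ℝ} (hg : Differentiable ℝ g) :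
    pdy (fun p => p.2 + g p.1) = fun _ => 1 := by
  funext p
  have h := (hasFDerivAt_snd (𝕜 := ℝ)).add
    ((hg p.1).hasDerivAt.comp_hasFDerivAt p (hasFDerivAt_fst (𝕜 := ℝ)))
  have h' : fderiv ℝ (fun p : ℝ × ℝ => p.2 + g p.1) p = _ := h.fderiv
  simp [pdy, h']

/-- The flat function `expNegInvGlue`, seen as a function of the first coordinate, has vanishing
derivatives of every order at the origin. -/
theorem iteratedFDeriv_expNegInvGlue_fst_zero (n : ℕ) :
    iteratedFDeriv ℝ n (fun p : ℝ × ℝ => expNegInvGlue p.1) ((0 : ℝ), (0 : ℝ)) = 0 := by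
  have hc : ContDiff ℝ n (fun p : ℝ × ℝ => expNegInvGlue p.1) :=
    expNegInvGlue.contDiff.comp contDiff_fst
  have hcont := hc.continuous_iteratedFDeriv (m := n) le_rfl
  have hline : Continuous fun t : ℝ => ((t, 0) : ℝ × ℝ) := by fun_prop
  have hclosed : IsClosed {t : ℝ |
      iteratedFDeriv ℝ n (fun p : ℝ × ℝ => expNegInvGlue p.1) (t, 0) = 0} :=
    isClosed_eq (hcont.comp hline) continuous_const
  have hsub : Set.Iio (0 : ℝ) ⊆ {t : ℝ |
      iteratedFDeriv ℝ n (fun p : ℝ × ℝ => expNegInvGlue p.1) (t, 0) = 0} := by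
    intro t ht
    have hev : (fun p : ℝ × ℝ => expNegInvGlue p.1) =ᶠ[nhds (t, 0)] 0 := by
      filter_upwards [continuous_fst.continuousAt.eventually_lt_const
        (show ((t, 0) : ℝ × ℝ).1 < 0 from ht)] with p hp
      exact expNegInvGlue.zero_of_nonpos hp.le
    have h := (hev.iteratedFDeriv ℝ n).eq_of_nhds
    simpa using h
  have h := hclosed.closure_subset_iff.mpr hsub
  rw [closure_Iio] at h
  exact h (Set.mem_Iic.mpr le_rfl)

/-- Counterexample to the SUCP for determinants of solutions of non-diagonal
second-order elliptic systems `ΔF + XF = 0` with `X = [[X₁₁∂_y, 0],[∂_x, 0]]`,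
`F = [[1, b],[0, c]]`, `det F = c`. -/
theorem stmt_1 :
    ∃ Ω : Set (ℝ × ℝ), IsOpen Ω ∧ ((0:ℝ), (0:ℝ)) ∈ Ω ∧
    ∃ X11 b c : ℝ × ℝ → ℝ,
      ContDiffOn ℝ (⊤ : ℕ∞) X11 Ω ∧
      ContDiffOn ℝ (⊤ : ℕ∞) b Ω ∧
      ContDiffOn ℝ (⊤ : ℕ∞) c Ω ∧
      (∀ p ∈ Ω, lap b p + X11 p * pdy b p = 0) ∧
      (∀ p ∈ Ω, lap c p + pdx b p = 0) ∧
      (∀ n : ℕ, iteratedFDeriv ℝ n c ((0:ℝ), (0:ℝ)) = 0) ∧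
      (∃ p ∈ Ω, c p ≠ 0) ∧
      (∀ p : ℝ × ℝ, Matrix.det !![(1:ℝ), b p; 0, c p] = c p) := by
  have hs (k : ℕ) : ContDiff ℝ (⊤ : ℕ∞) (deriv^[k] expNegInvGlue) :=
    ContDiff.iterate_deriv k expNegInvGlue.contDiff
  have hd (k : ℕ) : Differentiable ℝ (deriv^[k] expNegInvGlue) :=
    (hs k).differentiable (by simp)
  have hd0 : Differentiable ℝ expNegInvGlue := hd 0
  have hd1 : Differentiable ℝ (deriv expNegInvGlue) := hd 1
  have hd2 : Differentiable ℝ (deriv (deriv expNegInvGlue)) := hd 2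
  refine ⟨Set.univ, isOpen_univ, Set.mem_univ _,
    fun p => deriv (deriv (deriv expNegInvGlue)) p.1,
    fun p => p.2 + deriv expNegInvGlue p.1,
    fun p => expNegInvGlue p.1,
    ((hs 3).comp contDiff_fst).contDiffOn,
    (contDiff_snd.add ((hs 1).comp contDiff_fst)).contDiffOn,
    ((hs 0).comp contDiff_fst).contDiffOn,
    fun p _ => ?_, fun p _ => ?_, iteratedFDeriv_expNegInvGlue_fst_zero,
    ⟨(1, 0), Set.mem_univ _, (expNegInvGlue.pos_of_pos one_pos).ne'⟩, fun p => ?_⟩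
  · simp only [lap, pdx_snd_add_comp_fst hd1, pdy_snd_add_comp_fst hd1, pdx_comp_fst hd2]
    simp [pdy]
  · simp only [lap, pdx_snd_add_comp_fst hd1, pdx_comp_fst hd0, pdy_comp_fst hd0,
      pdx_comp_fst hd1]
    simp [pdy]
  · simp [Matrix.det_fin_two]
end

section
/- Let X₁₂ = α₁∂_x + α₂∂_y + α₃ and X₂₂ = β₁∂_x + β₂∂_y + β₃ be first-order scalar differential operators with smooth coefficients on an open neighborhood of 0 in ℝ², and let c be any smooth function on that neighborhood. Then there exist an open neighborhood Ω of 0 and smooth functions X₁₁, b : Ω → ℝ such that Δb + X₁₁ · ∂_y b + X₁₂(c) = 0 and Δc + ∂_x b + X₂₂(c) = 0 on Ω, where Δ = −(∂_x² + ∂_y²). Consequently F = [[1, b],[0, c]] satisfies ΔF + XF = 0 with X = [[X₁₁∂_y, X₁₂],[∂_x, X₂₂]], and det F = c; taking c vanishing to infinite order at 0 but not identically zero gives a counterexample to the strong unique continuation property for det F. -/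
open MeasureTheory

open scoped Convolution in
/-- Integrals over `[0, 1]` of a smooth function depend smoothly on the parameter. -/
theorem contDiff_integral_zero_one {P : Type*} [NormedAddCommGroup P] [NormedSpace ℝ P]
    {H : P × ℝ → ℝ} (hH : ContDiff ℝ (⊤ : ℕ∞) H) :
    ContDiff ℝ (⊤ : ℕ∞) (fun p => ∫ t in (0:ℝ)..1, H (p, t)) := by
  let χ : ContDiffBump (0 : ℝ) := ⟨1, 2, one_pos, one_lt_two⟩
  have key := contDiffOn_convolution_right_with_param_comp (μ := volume) (n := ⊤)
    (ContinuousLinearMap.mul ℝ ℝ) (s := (Set.univ : Set P)) (v := fun _ => (0 : ℝ)) contDiffOn_const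
    (f := (Set.Ioc (0 : ℝ) 1).indicator fun _ => (1 : ℝ))
    (g := fun p u => χ u * H (p, -u)) (k := Metric.closedBall 0 2) isOpen_univ
    (isCompact_closedBall _ _) ?_ ?_ ?_
  · rw [contDiffOn_univ] at key
    convert key using 2 with p
    rw [intervalIntegral.integral_of_le zero_le_one, convolution_def,
      ← integral_indicator measurableSet_Ioc]
    refine integral_congr_ae (.of_forall fun t => ?_)
    by_cases ht : t ∈ Set.Ioc (0 : ℝ) 1
    · have : χ (0 - t) = 1 := by
        apply χ.one_of_mem_closedBall
        simp only [Metric.mem_closedBall, dist_zero_right, zero_sub, norm_neg, Real.norm_eq_abs]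
        rw [abs_of_pos ht.1]
        exact ht.2
      simp only [Set.indicator_of_mem ht, this, ContinuousLinearMap.mul_apply']
      simp
    · simp [Set.indicator_of_notMem ht]
  · intro p u _ hu
    have : χ u = 0 := by
      apply χ.zero_of_le_dist
      simp only [Metric.mem_closedBall, not_le] at hu
      exact hu.le
    simp [this]
  · exact ((integrable_indicator_iff measurableSet_Ioc).2
      (integrableOn_const measure_Ioc_lt_top.ne)).locallyIntegrable
  · apply ContDiff.contDiffOn
    exact (χ.contDiff.comp contDiff_snd).mul (hH.comp (contDiff_fst.prodMk contDiff_snd.neg))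

/-- The primitive in the `x` direction, vanishing on the `y` axis, of a smooth function is smooth. -/
theorem contDiff_primitive_fst {G : ℝ × ℝ → ℝ} (hG : ContDiff ℝ (⊤ : ℕ∞) G) :
    ContDiff ℝ (⊤ : ℕ∞) (fun p : ℝ × ℝ => ∫ t in (0:ℝ)..p.1, G (t, p.2)) := by
  have h : (fun p : ℝ × ℝ => ∫ t in (0:ℝ)..p.1, G (t, p.2))
      = fun p : ℝ × ℝ => p.1 * ∫ t in (0:ℝ)..1, G (t * p.1, p.2) := by
    funext p
    rw [intervalIntegral.mul_integral_comp_mul_right (f := fun t => G (t, p.2))]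
    simp
  rw [h]
  refine contDiff_fst.mul
    (contDiff_integral_zero_one (H := fun q : (ℝ × ℝ) × ℝ => G (q.2 * q.1.1, q.1.2)) ?_)
  fun_prop

theorem pdx_eq_of_hasDerivAt {f : ℝ × ℝ → ℝ} {p : ℝ × ℝ} {d : ℝ} (hf : DifferentiableAt ℝ f p)
    (h : HasDerivAt (fun t => f (t, p.2)) d p.1) : pdx f p = d := by
  have h1 : HasDerivAt (fun t : ℝ => (t, p.2)) ((1 : ℝ), (0 : ℝ)) p.1 :=
    (hasDerivAt_id p.1).prodMk (hasDerivAt_const p.1 p.2)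
  exact (HasFDerivAt.comp_hasDerivAt (f := fun t : ℝ => (t, p.2)) p.1 hf.hasFDerivAt h1).unique h

theorem pdy_eq_of_hasDerivAt {f : ℝ × ℝ → ℝ} {p : ℝ × ℝ} {d : ℝ} (hf : DifferentiableAt ℝ f p)
    (h : HasDerivAt (fun t => f (p.1, t)) d p.2) : pdy f p = d := by
  have h1 : HasDerivAt (fun t : ℝ => (p.1, t)) ((0 : ℝ), (1 : ℝ)) p.2 :=
    (hasDerivAt_const p.2 p.1).prodMk (hasDerivAt_id p.2)
  exact (HasFDerivAt.comp_hasDerivAt (f := fun t : ℝ => (p.1, t)) p.2 hf.hasFDerivAt h1).unique h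

theorem ContDiffOn.pdx {f : ℝ × ℝ → ℝ} {U : Set (ℝ × ℝ)} (hf : ContDiffOn ℝ (⊤ : ℕ∞) f U)
    (hU : IsOpen U) : ContDiffOn ℝ (⊤ : ℕ∞) (pdx f) U :=
  (hf.fderiv_of_isOpen hU (by simp)).clm_apply contDiffOn_const

theorem ContDiffOn.pdy {f : ℝ × ℝ → ℝ} {U : Set (ℝ × ℝ)} (hf : ContDiffOn ℝ (⊤ : ℕ∞) f U)
    (hU : IsOpen U) : ContDiffOn ℝ (⊤ : ℕ∞) (pdy f) U :=
  (hf.fderiv_of_isOpen hU (by simp)).clm_apply contDiffOn_const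

theorem ContDiffOn.lap {f : ℝ × ℝ → ℝ} {U : Set (ℝ × ℝ)} (hf : ContDiffOn ℝ (⊤ : ℕ∞) f U)
    (hU : IsOpen U) : ContDiffOn ℝ (⊤ : ℕ∞) (lap f) U :=
  (((hf.pdx hU).pdx hU).add ((hf.pdy hU).pdy hU)).neg

/-- A function smooth near a point agrees near it with a globally smooth function. -/
theorem ContDiffOn.exists_contDiff_eqOn_ball {g : ℝ × ℝ → ℝ} {U : Set (ℝ × ℝ)} {p : ℝ × ℝ}
    (hg : ContDiffOn ℝ (⊤ : ℕ∞) g U) (hU : IsOpen U) (hp : p ∈ U) :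
    ∃ G : ℝ × ℝ → ℝ, ContDiff ℝ (⊤ : ℕ∞) G ∧
      ∃ r > 0, Metric.ball p r ⊆ U ∧ Set.EqOn G g (Metric.ball p r) := by
  obtain ⟨r, hr, hrU⟩ := Metric.nhds_basis_closedBall.mem_iff.1 (hU.mem_nhds hp)
  let χ : ContDiffBump p := ⟨r / 2, r, half_pos hr, half_lt_self hr⟩
  refine ⟨fun q => χ q * g q, ?_, r / 2, half_pos hr, ?_, fun q hq => ?_⟩
  · rw [contDiff_iff_contDiffAt]
    intro q
    by_cases hq : q ∈ U
    · exact χ.contDiff.contDiffAt.mul (hg.contDiffAt (hU.mem_nhds hq))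
    · have hq' : q ∉ tsupport χ := fun h => hq (hrU (χ.tsupport_eq ▸ h))
      refine (contDiffAt_const (c := (0 : ℝ))).congr_of_eventuallyEq ?_
      filter_upwards [notMem_tsupport_iff_eventuallyEq.1 hq'] with z hz
      simp [hz]
  · exact (Metric.ball_subset_closedBall.trans
      (Metric.closedBall_subset_closedBall (half_le_self hr.le))).trans hrU
  · simp [χ.one_of_mem_closedBall (Metric.ball_subset_closedBall hq)]

/-- Given first-order operators `X₁₂ = α₁∂_x + α₂∂_y + α₃` and
`X₂₂ = β₁∂_x + β₂∂_y + β₃` with smooth coefficients near `0` and any smooth `c`,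
there exist a neighbourhood `Ω` of `0` and smooth `X₁₁, b` on `Ω` with
`Δb + X₁₁·∂_y b + X₁₂(c) = 0` and `Δc + ∂_x b + X₂₂(c) = 0`; then
`F = [[1,b],[0,c]]` solves `ΔF + XF = 0` and `det F = c`. -/
theorem stmt_2 (U : Set (ℝ × ℝ)) (hU : IsOpen U) (h0 : ((0:ℝ), (0:ℝ)) ∈ U)
    (α₁ α₂ α₃ β₁ β₂ β₃ c : ℝ × ℝ → ℝ)
    (hα₁ : ContDiffOn ℝ (⊤ : ℕ∞) α₁ U) (hα₂ : ContDiffOn ℝ (⊤ : ℕ∞) α₂ U)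
    (hα₃ : ContDiffOn ℝ (⊤ : ℕ∞) α₃ U) (hβ₁ : ContDiffOn ℝ (⊤ : ℕ∞) β₁ U)
    (hβ₂ : ContDiffOn ℝ (⊤ : ℕ∞) β₂ U) (hβ₃ : ContDiffOn ℝ (⊤ : ℕ∞) β₃ U)
    (hc : ContDiffOn ℝ (⊤ : ℕ∞) c U) :
    ∃ Ω : Set (ℝ × ℝ), Ω ⊆ U ∧ IsOpen Ω ∧ ((0:ℝ), (0:ℝ)) ∈ Ω ∧
    ∃ X11 b : ℝ × ℝ → ℝ,
      ContDiffOn ℝ (⊤ : ℕ∞) X11 Ω ∧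
      ContDiffOn ℝ (⊤ : ℕ∞) b Ω ∧
      (∀ p ∈ Ω, lap b p + X11 p * pdy b p
        + (α₁ p * pdx c p + α₂ p * pdy c p + α₃ p * c p) = 0) ∧
      (∀ p ∈ Ω, lap c p + pdx b p
        + (β₁ p * pdx c p + β₂ p * pdy c p + β₃ p * c p) = 0) ∧
      (∀ p : ℝ × ℝ, Matrix.det !![(1:ℝ), b p; 0, c p] = c p) := by
  obtain ⟨G, hG, r, hr, hrU, hGr⟩ := ContDiffOn.exists_contDiff_eqOn_ball
    (g := fun p => -(lap c p + (β₁ p * pdx c p + β₂ p * pdy c p + β₃ p * c p)))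
    ((hc.lap hU).add (((hβ₁.mul (hc.pdx hU)).add (hβ₂.mul (hc.pdy hU))).add (hβ₃.mul hc))).neg
    hU h0
  let b : ℝ × ℝ → ℝ := fun p => p.2 + ∫ t in (0:ℝ)..p.1, G (t, p.2)
  have hb : ContDiff ℝ (⊤ : ℕ∞) b := contDiff_snd.add (contDiff_primitive_fst hG)
  have hbd : Differentiable ℝ b := hb.differentiable (by simp)
  have hbx : ∀ p, pdx b p = G p := fun p => by
    refine pdx_eq_of_hasDerivAt (hbd p) (HasDerivAt.const_add p.2 ?_)
    have hcont : Continuous fun t => G (t, p.2) := hG.continuous.comp (by fun_prop)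
    exact intervalIntegral.integral_hasDerivAt_right (hcont.intervalIntegrable _ _)
      hcont.stronglyMeasurable.stronglyMeasurableAtFilter hcont.continuousAt
  have hby : pdy b (0, 0) = 1 := by
    refine pdy_eq_of_hasDerivAt (hbd _) ?_
    simpa [b] using hasDerivAt_id' (0 : ℝ)
  have hb' : ContDiff ℝ (⊤ : ℕ∞) (pdy b) :=
    contDiffOn_univ.1 (hb.contDiffOn.pdy isOpen_univ)
  have hopen : IsOpen {p | pdy b p ≠ 0} := isOpen_ne_fun hb'.continuous continuous_const
  have hΩU : Metric.ball (0, 0) r ∩ {p | pdy b p ≠ 0} ⊆ U := Set.inter_subset_left.trans hrU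
  refine ⟨Metric.ball (0, 0) r ∩ {p | pdy b p ≠ 0}, hΩU, Metric.isOpen_ball.inter hopen,
    ⟨Metric.mem_ball_self hr, by simp [hby]⟩,
    fun p => -(lap b p + (α₁ p * pdx c p + α₂ p * pdy c p + α₃ p * c p)) / pdy b p, b,
    ?_, hb.contDiffOn, ?_, ?_, fun p => by simp [Matrix.det_fin_two]⟩
  · refine ContDiffOn.div (ContDiffOn.neg (ContDiffOn.add ?_ ?_)) hb'.contDiffOn fun p hp => hp.2
    · exact (hb.contDiffOn.lap isOpen_univ).mono (Set.subset_univ _)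
    · exact (((hα₁.mul (hc.pdx hU)).add (hα₂.mul (hc.pdy hU))).add (hα₃.mul hc)).mono hΩU
  · intro p hp
    have hp2 : pdy b p ≠ 0 := hp.2
    field_simp
    ring
  · intro p hp
    rw [hbx, hGr hp.1]
    ring
end

section
/- There exist ε > 0, smooth functions a, b, c, d : B_{2ε} → ℝ on the ball B_{2ε} ⊂ ℝ⁴ centered at 0 with a, b, c, d ≥ 1/2 everywhere, and smooth functions f₁, f₂, f₃ : B_{2ε} → ℝ such that (a∂₁² + b∂₂² + c∂₃² + d∂₄²)fᵢ = 0 on B_{2ε} for i = 1, 2, 3, f₁f₂ = f₃ on B_ε, but f₁f₂ ≠ f₃ at some point of B_{2ε} \ B_ε. Consequently the matrix F = [[f₃, f₂],[f₁, 1]] satisfies the diagonal elliptic system (a∂₁² + b∂₂² + c∂₃² + d∂₄²)F = 0 entrywise, det F = 0 on B_ε, but det F ≢ 0 on B_{2ε}; hence the weak unique continuation property for det F fails for diagonal second-order elliptic operators in dimension 4. -/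
/-- Partial derivative in the `i`-th coordinate direction on `ℝ⁴`. -/
noncomputable def pd4 (i : Fin 4) (f : EuclideanSpace ℝ (Fin 4) → ℝ)
    (p : EuclideanSpace ℝ (Fin 4)) : ℝ :=
  fderiv ℝ f p (EuclideanSpace.single i 1)

theorem pd4_const (i : Fin 4) (r : ℝ) : pd4 i (fun _ => r) = fun _ => 0 := by
  funext p
  simp [pd4]

theorem pd4_coord (i j : Fin 4) :
    pd4 i (fun p => p j) = fun _ => if j = i then 1 else 0 := by
  funext p
  have h : HasFDerivAt (fun q : EuclideanSpace ℝ (Fin 4) => q j)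
      (EuclideanSpace.proj j : EuclideanSpace ℝ (Fin 4) →L[ℝ] ℝ) p :=
    (EuclideanSpace.proj j : EuclideanSpace ℝ (Fin 4) →L[ℝ] ℝ).hasFDerivAt
  simp [pd4, h.fderiv]

theorem pd4_neg_coord (i j : Fin 4) :
    pd4 i (fun p => -p j) = fun _ => -if j = i then 1 else 0 := by
  funext p
  have := congrFun (pd4_coord i j) p
  simp only [pd4] at this ⊢
  simp [this]

theorem pd4_add (i : Fin 4) {f g : EuclideanSpace ℝ (Fin 4) → ℝ}
    (hf : Differentiable ℝ f) (hg : Differentiable ℝ g) :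
    pd4 i (fun p => f p + g p) = fun p => pd4 i f p + pd4 i g p := by
  funext p
  simp [pd4, fderiv_fun_add (hf p) (hg p)]

theorem pd4_sub (i : Fin 4) {f g : EuclideanSpace ℝ (Fin 4) → ℝ}
    (hf : Differentiable ℝ f) (hg : Differentiable ℝ g) :
    pd4 i (fun p => f p - g p) = fun p => pd4 i f p - pd4 i g p := by
  funext p
  simp [pd4, fderiv_fun_sub (hf p) (hg p)]

theorem pd4_mul (i : Fin 4) {f g : EuclideanSpace ℝ (Fin 4) → ℝ}
    (hf : Differentiable ℝ f) (hg : Differentiable ℝ g) :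
    pd4 i (fun p => f p * g p) = fun p => f p * pd4 i g p + g p * pd4 i f p := by
  funext p
  simp [pd4, fderiv_fun_mul (hf p) (hg p)]

theorem pd4_comp_coord (i j : Fin 4) {h : ℝ → ℝ} (hh : Differentiable ℝ h) :
    pd4 i (fun p => h (p j)) = fun p => deriv h (p j) * if j = i then 1 else 0 := by
  funext p
  have hc : HasFDerivAt (fun q : EuclideanSpace ℝ (Fin 4) => q j)
      (EuclideanSpace.proj j : EuclideanSpace ℝ (Fin 4) →L[ℝ] ℝ) p :=
    (EuclideanSpace.proj j : EuclideanSpace ℝ (Fin 4) →L[ℝ] ℝ).hasFDerivAt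
  have := (hh (p j)).hasDerivAt.comp_hasFDerivAt p hc
  simp only [Function.comp_def] at this
  simp [pd4, this.fderiv]

theorem ContDiff.differentiable_pd4 (i : Fin 4) {f : EuclideanSpace ℝ (Fin 4) → ℝ}
    (hf : ContDiff ℝ (⊤ : ℕ∞) f) : Differentiable ℝ (pd4 i f) := by
  have : ContDiff ℝ (⊤ : ℕ∞) (pd4 i f) :=
    (hf.fderiv_right (m := (⊤ : ℕ∞)) (by simp)).clm_apply contDiff_const
  exact this.differentiable (by simp)

theorem pd4_pd4_mul (i : Fin 4) {f g : EuclideanSpace ℝ (Fin 4) → ℝ}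
    (hf : ContDiff ℝ (⊤ : ℕ∞) f) (hg : ContDiff ℝ (⊤ : ℕ∞) g) :
    pd4 i (pd4 i (fun p => f p * g p)) = fun p =>
      f p * pd4 i (pd4 i g) p + g p * pd4 i (pd4 i f) p + 2 * (pd4 i f p * pd4 i g p) := by
  have hf' := hf.differentiable (by simp)
  have hg' := hg.differentiable (by simp)
  have hdf := hf.differentiable_pd4 i
  have hdg := hg.differentiable_pd4 i
  rw [pd4_mul i hf' hg', pd4_add i (hf'.fun_mul hdg) (hg'.fun_mul hdf), pd4_mul i hf' hdg,
    pd4_mul i hg' hdf]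
  funext p
  ring

theorem pd4_pd4_add (i : Fin 4) {f g : EuclideanSpace ℝ (Fin 4) → ℝ}
    (hf : ContDiff ℝ (⊤ : ℕ∞) f) (hg : ContDiff ℝ (⊤ : ℕ∞) g) :
    pd4 i (pd4 i (fun p => f p + g p)) = fun p => pd4 i (pd4 i f) p + pd4 i (pd4 i g) p := by
  rw [pd4_add i (hf.differentiable (by simp)) (hg.differentiable (by simp)),
    pd4_add i (hf.differentiable_pd4 i) (hg.differentiable_pd4 i)]

/-- A smooth function vanishing exactly on `(-∞, r]`, with small second derivative on `[-1, 1]`. -/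
theorem exists_flat_function (r : ℝ) : ∃ h : ℝ → ℝ, ContDiff ℝ (⊤ : ℕ∞) h ∧
    (∀ s ≤ r, h s = 0) ∧ (∀ s, r < s → 0 < h s) ∧
    ∀ s ∈ Set.Icc (-1 : ℝ) 1, |deriv (deriv h) s| ≤ 1 := by
  set g : ℝ → ℝ := fun s => expNegInvGlue (s - r)
  have hg : ContDiff ℝ (⊤ : ℕ∞) g := expNegInvGlue.contDiff.comp (contDiff_id.sub contDiff_const)
  have hg' : ContDiff ℝ (⊤ : ℕ∞) (deriv g) := (contDiff_infty_iff_deriv.1 hg).2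
  have hg'' : ContDiff ℝ (⊤ : ℕ∞) (deriv (deriv g)) := (contDiff_infty_iff_deriv.1 hg').2
  obtain ⟨M, hM⟩ := isCompact_Icc.exists_bound_of_continuousOn
    (s := Set.Icc (-1 : ℝ) 1) hg''.continuous.continuousOn
  have hpos : 0 < |M| + 1 := by positivity
  refine ⟨fun s => (|M| + 1)⁻¹ * g s, contDiff_const.mul hg, fun s hs => ?_, fun s hs => ?_,
    fun s hs => ?_⟩
  · simp [g, expNegInvGlue.zero_of_nonpos (sub_nonpos.2 hs)]
  · exact mul_pos (inv_pos.2 hpos) (expNegInvGlue.pos_of_pos (sub_pos.2 hs))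
  · have h1 : deriv (fun s => (|M| + 1)⁻¹ * g s) = fun s => (|M| + 1)⁻¹ * deriv g s := by
      funext s
      exact deriv_const_mul_field _
    rw [h1, deriv_const_mul_field, abs_mul, abs_of_pos (inv_pos.2 hpos), inv_mul_le_iff₀ hpos]
    have := hM s hs
    rw [Real.norm_eq_abs] at this
    linarith [le_abs_self M]

/-- Failure of the WUCP for determinants of matrix solutions of diagonal
second-order elliptic operators `a∂₁² + b∂₂² + c∂₃² + d∂₄²` in dimension 4. -/
theorem stmt_4 :
    ∃ ε : ℝ, 0 < ε ∧
    ∃ a b c d f₁ f₂ f₃ : EuclideanSpace ℝ (Fin 4) → ℝ,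
      ContDiffOn ℝ (⊤ : ℕ∞) a (Metric.ball 0 (2*ε)) ∧
      ContDiffOn ℝ (⊤ : ℕ∞) b (Metric.ball 0 (2*ε)) ∧
      ContDiffOn ℝ (⊤ : ℕ∞) c (Metric.ball 0 (2*ε)) ∧
      ContDiffOn ℝ (⊤ : ℕ∞) d (Metric.ball 0 (2*ε)) ∧
      ContDiffOn ℝ (⊤ : ℕ∞) f₁ (Metric.ball 0 (2*ε)) ∧
      ContDiffOn ℝ (⊤ : ℕ∞) f₂ (Metric.ball 0 (2*ε)) ∧
      ContDiffOn ℝ (⊤ : ℕ∞) f₃ (Metric.ball 0 (2*ε)) ∧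
      (∀ p ∈ Metric.ball (0 : EuclideanSpace ℝ (Fin 4)) (2*ε),
        (1:ℝ)/2 ≤ a p ∧ (1:ℝ)/2 ≤ b p ∧ (1:ℝ)/2 ≤ c p ∧ (1:ℝ)/2 ≤ d p) ∧
      (∀ f ∈ ({f₁, f₂, f₃} : Set (EuclideanSpace ℝ (Fin 4) → ℝ)),
        ∀ p ∈ Metric.ball (0 : EuclideanSpace ℝ (Fin 4)) (2*ε),
          a p * pd4 0 (pd4 0 f) p + b p * pd4 1 (pd4 1 f) p
            + c p * pd4 2 (pd4 2 f) p + d p * pd4 3 (pd4 3 f) p = 0) ∧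
      (∀ p ∈ Metric.ball (0 : EuclideanSpace ℝ (Fin 4)) ε, f₁ p * f₂ p = f₃ p) ∧
      (∃ p ∈ Metric.ball (0 : EuclideanSpace ℝ (Fin 4)) (2*ε) \ Metric.ball 0 ε,
        f₁ p * f₂ p ≠ f₃ p) ∧
      (∀ p ∈ Metric.ball (0 : EuclideanSpace ℝ (Fin 4)) ε,
        Matrix.det !![f₃ p, f₂ p; f₁ p, 1] = 0) ∧
      (∃ p ∈ Metric.ball (0 : EuclideanSpace ℝ (Fin 4)) (2*ε),
        Matrix.det !![f₃ p, f₂ p; f₁ p, 1] ≠ 0) := by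
  obtain ⟨h, hh, h_zero, h_pos, h_bound⟩ := exists_flat_function (1 / 20)
  have hh' : ContDiff ℝ (⊤ : ℕ∞) (deriv h) := (contDiff_infty_iff_deriv.1 hh).2
  have hh'' : ContDiff ℝ (⊤ : ℕ∞) (deriv (deriv h)) := (contDiff_infty_iff_deriv.1 hh').2
  have hd : Differentiable ℝ h := hh.differentiable (by simp)
  have hd' : Differentiable ℝ (deriv h) := hh'.differentiable (by simp)
  have coord_bound {p : EuclideanSpace ℝ (Fin 4)} {r : ℝ} (hp : p ∈ Metric.ball 0 r)
      (i : Fin 4) : |p i| < r :=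
    (PiLp.norm_apply_le p i).trans_lt (mem_ball_zero_iff.1 hp)
  have h_vanish {p : EuclideanSpace ℝ (Fin 4)} (hp : p ∈ Metric.ball 0 (1 / 20)) :
      h (p 2) = 0 :=
    h_zero _ ((le_abs_self _).trans (coord_bound hp 2).le)
  set q : EuclideanSpace ℝ (Fin 4) := EuclideanSpace.single 2 (3 / 40)
  have hq_norm : ‖q‖ = 3 / 40 := by simp [q]
  have hq : 0 < h (q 2) := h_pos _ (by simp [q]; norm_num)
  have hq_ball : q ∈ Metric.ball 0 (2 * (1 / 20)) := by
    rw [mem_ball_zero_iff, hq_norm]; norm_num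
  set f₁ : EuclideanSpace ℝ (Fin 4) → ℝ := fun p =>
    p 0 + p 1 + 1 / 2 * (p 0 * p 0 + p 1 * p 1 - p 2 * p 2 - p 3 * p 3) with hf₁
  set f₂ : EuclideanSpace ℝ (Fin 4) → ℝ := fun p =>
    p 0 - p 1 + 1 / 2 * (p 2 * p 2 - p 3 * p 3) with hf₂
  set N : EuclideanSpace ℝ (Fin 4) → ℝ := fun p =>
    p 1 - p 0 + p 2 * p 2 - p 3 * p 3 - 1 / 2 * deriv (deriv h) (p 2) with hN
  have hc (i : Fin 4) : ContDiff ℝ (⊤ : ℕ∞) (fun p : EuclideanSpace ℝ (Fin 4) => p i) := by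
    fun_prop
  have hN_smooth : ContDiff ℝ (⊤ : ℕ∞) N := by
    have := hh''.comp (hc 2)
    simp only [Function.comp_def] at this
    fun_prop
  have hf₁_smooth : ContDiff ℝ (⊤ : ℕ∞) f₁ := by fun_prop
  have hf₂_smooth : ContDiff ℝ (⊤ : ℕ∞) f₂ := by fun_prop
  have hf₃_smooth : ContDiff ℝ (⊤ : ℕ∞) (fun p => f₁ p * f₂ p + h (p 2)) :=
    (hf₁_smooth.mul hf₂_smooth).add (hh.comp (hc 2))
  have d10 : pd4 0 f₁ = fun p => 1 + p 0 := by
    simp (disch := fun_prop) only [hf₁, pd4_add, pd4_sub, pd4_mul, pd4_const, pd4_coord]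
    funext p
    simp
    ring
  have d11 : pd4 1 f₁ = fun p => 1 + p 1 := by
    simp (disch := fun_prop) only [hf₁, pd4_add, pd4_sub, pd4_mul, pd4_const, pd4_coord]
    funext p
    simp
    ring
  have d12 : pd4 2 f₁ = fun p => -p 2 := by
    simp (disch := fun_prop) only [hf₁, pd4_add, pd4_sub, pd4_mul, pd4_const, pd4_coord]
    funext p
    simp
    ring
  have d13 : pd4 3 f₁ = fun p => -p 3 := by
    simp (disch := fun_prop) only [hf₁, pd4_add, pd4_sub, pd4_mul, pd4_const, pd4_coord]
    funext p
    simp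
    ring
  have d20 : pd4 0 f₂ = fun _ => 1 := by
    simp (disch := fun_prop) only [hf₂, pd4_add, pd4_sub, pd4_mul, pd4_const, pd4_coord]
    funext p
    simp
  have d21 : pd4 1 f₂ = fun _ => -1 := by
    simp (disch := fun_prop) only [hf₂, pd4_add, pd4_sub, pd4_mul, pd4_const, pd4_coord]
    funext p
    simp
  have d22 : pd4 2 f₂ = fun p => p 2 := by
    simp (disch := fun_prop) only [hf₂, pd4_add, pd4_sub, pd4_mul, pd4_const, pd4_coord]
    funext p
    simp
    ring
  have d23 : pd4 3 f₂ = fun p => -p 3 := by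
    simp (disch := fun_prop) only [hf₂, pd4_add, pd4_sub, pd4_mul, pd4_const, pd4_coord]
    funext p
    simp
    ring
  refine ⟨1 / 20, by norm_num, fun p => 2 + p 0 + p 1 + N p, fun p => 2 + p 0 + p 1 - N p,
    fun p => 2 + p 0 + p 1, fun p => 2 + p 0 + p 1, f₁, f₂, fun p => f₁ p * f₂ p + h (p 2),
    ContDiff.contDiffOn (by fun_prop), ContDiff.contDiffOn (by fun_prop),
    ContDiff.contDiffOn (by fun_prop), ContDiff.contDiffOn (by fun_prop),
    hf₁_smooth.contDiffOn, hf₂_smooth.contDiffOn, hf₃_smooth.contDiffOn,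
    fun p hp => ?_, fun f hf p _ => ?_, fun p hp => ?_, ⟨q, ⟨hq_ball, ?_⟩, ?_⟩,
    fun p hp => ?_, ⟨q, hq_ball, ?_⟩⟩
  · have h0 := abs_lt.1 (coord_bound hp 0)
    have h1 := abs_lt.1 (coord_bound hp 1)
    have h2 := abs_lt.1 (coord_bound hp 2)
    have h3 := abs_lt.1 (coord_bound hp 3)
    have hb := abs_le.1 (h_bound (p 2) ⟨by linarith, by linarith⟩)
    have s3 : p 3 * p 3 ≤ 1 / 100 := by nlinarith
    have s2 : p 2 * p 2 ≤ 1 / 100 := by nlinarith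
    have t2 := mul_self_nonneg (p 2)
    have t3 := mul_self_nonneg (p 3)
    simp only [hN]
    refine ⟨?_, ?_, ?_, ?_⟩ <;> linarith
  · rcases hf with rfl | rfl | rfl
    · simp only [d10, d11, d12, d13]
      simp (disch := fun_prop) [pd4_add, pd4_const, pd4_coord, pd4_neg_coord]
      ring
    · simp only [d20, d21, d22, d23]
      simp (disch := fun_prop) [pd4_const, pd4_coord, pd4_neg_coord]
    · have hf₁₂ : ContDiff ℝ (⊤ : ℕ∞) (fun p => f₁ p * f₂ p) := hf₁_smooth.mul hf₂_smooth
      have hh₂ : ContDiff ℝ (⊤ : ℕ∞) (fun p : EuclideanSpace ℝ (Fin 4) => h (p 2)) :=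
        hh.comp (hc 2)
      simp only [pd4_pd4_add _ hf₁₂ hh₂, pd4_pd4_mul _ hf₁_smooth hf₂_smooth, d10, d11, d12,
        d13, d20, d21, d22, d23]
      simp (disch := fun_prop) only [pd4_add, pd4_mul, pd4_const, pd4_coord, pd4_neg_coord,
        pd4_comp_coord]
      simp [hN]
      ring
  · simp [h_vanish hp]
  · rw [mem_ball_zero_iff, hq_norm]; norm_num
  · simp [hq.ne']
  · simp [Matrix.det_fin_two, h_vanish hp, mul_comm]
  · simp [Matrix.det_fin_two, mul_comm (f₂ q), hq.ne']
end

section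
/- There exist ε > 0, smooth functions a, b, c, d : B_{2ε} → ℝ on the ball B_{2ε} ⊂ ℝ³ centered at 0 such that at every point the quadratic form a ξ₁² + b ξ₂² + c ξ₃² + 2d ξ₁ξ₂ is positive definite (so the operator L = a∂₁² + b∂₂² + c∂₃² + 2d∂₁∂₂ is strongly elliptic), and smooth functions f₁, f₂, f₃ : B_{2ε} → ℝ such that Lfᵢ = 0 on B_{2ε} for i = 1, 2, 3, f₁f₂ = f₃ on B_ε, but f₁f₂ ≠ f₃ at some point of B_{2ε} \ B_ε. Consequently F = [[f₃, f₂],[f₁, 1]] satisfies LF = 0 entrywise, det F = 0 on B_ε but det F ≢ 0 on B_{2ε}, so the weak unique continuation property for det F fails in dimension 3. -/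
/-- Partial derivative in the `i`-th coordinate direction on `ℝ³`. -/
noncomputable def pd3 (i : Fin 3) (f : EuclideanSpace ℝ (Fin 3) → ℝ)
    (p : EuclideanSpace ℝ (Fin 3)) : ℝ :=
  fderiv ℝ f p (EuclideanSpace.single i 1)

theorem pd3_eq_of_hasFDerivAt {f : EuclideanSpace ℝ (Fin 3) → ℝ}
    {f' : EuclideanSpace ℝ (Fin 3) →L[ℝ] ℝ} {p : EuclideanSpace ℝ (Fin 3)}
    (h : HasFDerivAt f f' p) (i : Fin 3) : pd3 i f p = f' (EuclideanSpace.single i 1) := by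
  rw [pd3, h.fderiv]

theorem hasFDerivAt_coord (j : Fin 3) (p : EuclideanSpace ℝ (Fin 3)) :
    HasFDerivAt (fun q : EuclideanSpace ℝ (Fin 3) => q j)
      (EuclideanSpace.proj j : EuclideanSpace ℝ (Fin 3) →L[ℝ] ℝ) p :=
  (EuclideanSpace.proj j : EuclideanSpace ℝ (Fin 3) →L[ℝ] ℝ).hasFDerivAt

theorem pd3_const (i : Fin 3) (r : ℝ) : pd3 i (fun _ => r) = fun _ => 0 := by
  funext p
  simp [pd3]

theorem pd3_coord (i j : Fin 3) : pd3 i (fun p => p j) = fun _ => if j = i then 1 else 0 := by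
  funext p
  rw [pd3_eq_of_hasFDerivAt (hasFDerivAt_coord j p)]
  simp

theorem pd3_comp_coord (i j : Fin 3) {u : ℝ → ℝ} (hu : Differentiable ℝ u) :
    pd3 i (fun p => u (p j)) = fun p => deriv u (p j) * if j = i then 1 else 0 := by
  funext p
  refine (pd3_eq_of_hasFDerivAt
    ((hu (p j)).hasDerivAt.comp_hasFDerivAt p (hasFDerivAt_coord j p)) i).trans ?_
  simp

theorem pd3_mul_add_comp (i : Fin 3) {u : ℝ → ℝ} (hu : Differentiable ℝ u) :
    pd3 i (fun p => p 0 * p 1 + u (p 2)) = fun p =>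
      (p 0 * if (1 : Fin 3) = i then 1 else 0) + (p 1 * if (0 : Fin 3) = i then 1 else 0)
        + deriv u (p 2) * if (2 : Fin 3) = i then 1 else 0 := by
  funext p
  refine (pd3_eq_of_hasFDerivAt
    (((hasFDerivAt_coord 0 p).mul (hasFDerivAt_coord 1 p)).add
      ((hu (p 2)).hasDerivAt.comp_hasFDerivAt p (hasFDerivAt_coord 2 p))) i).trans ?_
  simp

/-- Failure of the WUCP for determinants of matrix solutions of the strongly
elliptic operator `L = a∂₁² + b∂₂² + c∂₃² + 2d∂₁∂₂` in dimension 3. -/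
theorem stmt_5 :
    ∃ ε : ℝ, 0 < ε ∧
    ∃ a b c d f₁ f₂ f₃ : EuclideanSpace ℝ (Fin 3) → ℝ,
      ContDiffOn ℝ (⊤ : ℕ∞) a (Metric.ball 0 (2*ε)) ∧
      ContDiffOn ℝ (⊤ : ℕ∞) b (Metric.ball 0 (2*ε)) ∧
      ContDiffOn ℝ (⊤ : ℕ∞) c (Metric.ball 0 (2*ε)) ∧
      ContDiffOn ℝ (⊤ : ℕ∞) d (Metric.ball 0 (2*ε)) ∧
      ContDiffOn ℝ (⊤ : ℕ∞) f₁ (Metric.ball 0 (2*ε)) ∧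
      ContDiffOn ℝ (⊤ : ℕ∞) f₂ (Metric.ball 0 (2*ε)) ∧
      ContDiffOn ℝ (⊤ : ℕ∞) f₃ (Metric.ball 0 (2*ε)) ∧
      (∀ p ∈ Metric.ball (0 : EuclideanSpace ℝ (Fin 3)) (2*ε),
        ∀ ξ : Fin 3 → ℝ, ξ ≠ 0 →
          0 < a p * ξ 0 ^ 2 + b p * ξ 1 ^ 2 + c p * ξ 2 ^ 2 + 2 * d p * ξ 0 * ξ 1) ∧
      (∀ f ∈ ({f₁, f₂, f₃} : Set (EuclideanSpace ℝ (Fin 3) → ℝ)),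
        ∀ p ∈ Metric.ball (0 : EuclideanSpace ℝ (Fin 3)) (2*ε),
          a p * pd3 0 (pd3 0 f) p + b p * pd3 1 (pd3 1 f) p
            + c p * pd3 2 (pd3 2 f) p + 2 * d p * pd3 0 (pd3 1 f) p = 0) ∧
      (∀ p ∈ Metric.ball (0 : EuclideanSpace ℝ (Fin 3)) ε, f₁ p * f₂ p = f₃ p) ∧
      (∃ p ∈ Metric.ball (0 : EuclideanSpace ℝ (Fin 3)) (2*ε) \ Metric.ball 0 ε,
        f₁ p * f₂ p ≠ f₃ p) ∧
      (∀ p ∈ Metric.ball (0 : EuclideanSpace ℝ (Fin 3)) ε,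
        Matrix.det !![f₃ p, f₂ p; f₁ p, 1] = 0) ∧
      (∃ p ∈ Metric.ball (0 : EuclideanSpace ℝ (Fin 3)) (2*ε),
        Matrix.det !![f₃ p, f₂ p; f₁ p, 1] ≠ 0) := by
  obtain ⟨u, hu, hu0, hu1⟩ : ∃ u : ℝ → ℝ, ContDiff ℝ (⊤ : ℕ∞) u ∧
      (∀ t ≤ 1, u t = 0) ∧ ∀ t, 1 < t → u t ≠ 0 :=
    ⟨fun t => expNegInvGlue (t - 1),
      expNegInvGlue.contDiff.comp (contDiff_id.sub contDiff_const),
      fun t ht => expNegInvGlue.zero_of_nonpos (by linarith),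
      fun t ht => (expNegInvGlue.pos_of_pos (by linarith)).ne'⟩
  have hu' : ContDiff ℝ (⊤ : ℕ∞) (deriv u) := ((contDiff_infty_iff_deriv).1 hu).2
  have hu'' : ContDiff ℝ (⊤ : ℕ∞) (deriv (deriv u)) := ((contDiff_infty_iff_deriv).1 hu').2
  have hd : Differentiable ℝ u := hu.differentiable (by simp)
  have hd' : Differentiable ℝ (deriv u) := hu'.differentiable (by simp)
  have hpos (t : ℝ) : 0 < 1 + deriv (deriv u) t ^ 2 := by positivity
  have hcoord (j : Fin 3) : ContDiff ℝ (⊤ : ℕ∞) (fun p : EuclideanSpace ℝ (Fin 3) => p j) :=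
    (EuclideanSpace.proj j : EuclideanSpace ℝ (Fin 3) →L[ℝ] ℝ).contDiff
  have hw : ContDiff ℝ (⊤ : ℕ∞)
      (fun p : EuclideanSpace ℝ (Fin 3) => deriv (deriv u) (p 2)) := hu''.comp (hcoord 2)
  have hzero : ∀ p ∈ Metric.ball (0 : EuclideanSpace ℝ (Fin 3)) 1, u (p 2) = 0 := by
    intro p hp
    have h₁ : ‖p 2‖ ≤ ‖p‖ := PiLp.norm_apply_le p 2
    rw [mem_ball_zero_iff] at hp
    exact hu0 _ ((le_abs_self (p 2)).trans (h₁.trans hp.le))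
  have hq : u ((EuclideanSpace.single (2 : Fin 3) (3 / 2 : ℝ)) 2) ≠ 0 :=
    hu1 _ (by norm_num)
  have hq2 : EuclideanSpace.single (2 : Fin 3) (3 / 2 : ℝ) ∈ Metric.ball 0 (2 * 1) := by
    rw [mem_ball_zero_iff, PiLp.norm_single]; norm_num
  have hq1 : EuclideanSpace.single (2 : Fin 3) (3 / 2 : ℝ) ∉ Metric.ball 0 1 :=
    fun h => hq (hzero _ h)
  refine ⟨1, one_pos, fun _ => 1, fun _ => 1, fun p => 1 / (1 + deriv (deriv u) (p 2) ^ 2),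
    fun p => -(deriv (deriv u) (p 2) / 2) / (1 + deriv (deriv u) (p 2) ^ 2),
    fun p => p 0, fun p => p 1, fun p => p 0 * p 1 + u (p 2),
    contDiffOn_const, contDiffOn_const,
    (contDiff_const.div (contDiff_const.add (hw.pow 2)) fun p => (hpos _).ne').contDiffOn,
    ((hw.div_const 2).neg.div (contDiff_const.add (hw.pow 2)) fun p => (hpos _).ne').contDiffOn,
    (hcoord 0).contDiffOn, (hcoord 1).contDiffOn,
    (((hcoord 0).mul (hcoord 1)).add (hu.comp (hcoord 2))).contDiffOn, ?_, ?_, ?_, ?_, ?_, ?_⟩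
  · intro p _ ξ hξ
    dsimp only
    set w := deriv (deriv u) (p 2)
    have hw0 : 0 < 1 + w ^ 2 := hpos _
    have key : 1 * ξ 0 ^ 2 + 1 * ξ 1 ^ 2 + 1 / (1 + w ^ 2) * ξ 2 ^ 2
          + 2 * (-(w / 2) / (1 + w ^ 2)) * ξ 0 * ξ 1
        = (((ξ 0 - w * ξ 1 / 2) ^ 2 + 3 / 4 * w ^ 2 * ξ 1 ^ 2 + w ^ 2 * ξ 0 ^ 2 + ξ 1 ^ 2)
          + ξ 2 ^ 2) / (1 + w ^ 2) := by
      field_simp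
      ring
    rw [key]
    refine div_pos ?_ hw0
    by_contra! hle
    have h₁ : ξ 1 = 0 := by
      by_contra h
      have : 0 < ξ 1 ^ 2 := by positivity
      have : 0 ≤ (ξ 0 - w * ξ 1 / 2) ^ 2 + 3 / 4 * w ^ 2 * ξ 1 ^ 2 + w ^ 2 * ξ 0 ^ 2 + ξ 2 ^ 2 := by
        positivity
      linarith
    rw [h₁] at hle
    have h₂ : ξ 2 = 0 := by
      by_contra h
      have : 0 < ξ 2 ^ 2 := by positivity
      nlinarith [sq_nonneg (w * ξ 0), sq_nonneg (ξ 0)]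
    have h₀ : ξ 0 = 0 := by
      by_contra h
      have : 0 < ξ 0 ^ 2 := by positivity
      nlinarith [sq_nonneg (w * ξ 0), sq_nonneg (ξ 2)]
    exact hξ (by ext i; fin_cases i <;> simp [h₀, h₁, h₂])
  · rintro f (rfl | rfl | rfl) p _
    · simp only [pd3_coord, pd3_const]; ring
    · simp only [pd3_coord, pd3_const]; ring
    · have := (hpos (p 2)).ne'
      simp only [pd3_mul_add_comp _ hd]
      simp [pd3_coord, pd3_comp_coord _ _ hd']
      field_simp
      ring
  · intro p hp
    simp [hzero p hp]
  · exact ⟨_, ⟨hq2, hq1⟩, fun h => hq (by simpa using h.symm)⟩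
  · intro p hp
    simp [hzero p hp, Matrix.det_fin_two, mul_comm]
  · exact ⟨_, hq2, by simpa [Matrix.det_fin_two] using hq⟩
end

section
/- There exist ε > 0, smooth functions a, b, c, d : B_{2ε} → ℝ on the ball B_{2ε} ⊂ ℝ² centered at 0 with a and b positive everywhere (so L = a∂₁² + b∂₂² + c∂₁ + d∂₂ is elliptic), and smooth functions f₁, f₂, f₃ : B_{2ε} → ℝ such that Lfᵢ = 0 on B_{2ε} for i = 1, 2, 3, f₁f₂ = f₃ on B_ε, but f₁f₂ ≠ f₃ at some point of B_{2ε} \ B_ε. Consequently F = [[f₃, f₂],[f₁, 1]] satisfies LF = 0 entrywise, det F = 0 on B_ε but det F ≢ 0 on B_{2ε}, so the weak unique continuation property for det F fails for diagonal second-order elliptic operators with first-order terms in dimension 2. -/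
/-- Partial derivative in the `i`-th coordinate direction on `ℝ²`. -/
noncomputable def pd2 (i : Fin 2) (f : EuclideanSpace ℝ (Fin 2) → ℝ)
    (p : EuclideanSpace ℝ (Fin 2)) : ℝ :=
  fderiv ℝ f p (EuclideanSpace.single i 1)

theorem hasFDerivAt_separated {F G : ℝ → ℝ} (hF : Differentiable ℝ F) (hG : Differentiable ℝ G)
    (p : EuclideanSpace ℝ (Fin 2)) :
    HasFDerivAt (fun q : EuclideanSpace ℝ (Fin 2) => F (q 0) + G (q 1))
      (deriv F (p 0) • (EuclideanSpace.proj 0 : EuclideanSpace ℝ (Fin 2) →L[ℝ] ℝ)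
        + deriv G (p 1) • (EuclideanSpace.proj 1 : EuclideanSpace ℝ (Fin 2) →L[ℝ] ℝ)) p := by
  have h (i : Fin 2) : HasFDerivAt (fun q : EuclideanSpace ℝ (Fin 2) => q i)
      (EuclideanSpace.proj i : EuclideanSpace ℝ (Fin 2) →L[ℝ] ℝ) p :=
    (EuclideanSpace.proj i : EuclideanSpace ℝ (Fin 2) →L[ℝ] ℝ).hasFDerivAt
  exact ((hF (p 0)).hasDerivAt.comp_hasFDerivAt p (h 0)).add
    ((hG (p 1)).hasDerivAt.comp_hasFDerivAt p (h 1))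

theorem pd2_zero_separated {F G : ℝ → ℝ} (hF : Differentiable ℝ F) (hG : Differentiable ℝ G) :
    pd2 0 (fun q => F (q 0) + G (q 1)) = fun p => deriv F (p 0) := by
  funext p
  simp [pd2, (hasFDerivAt_separated hF hG p).fderiv]

theorem pd2_one_separated {F G : ℝ → ℝ} (hF : Differentiable ℝ F) (hG : Differentiable ℝ G) :
    pd2 1 (fun q => F (q 0) + G (q 1)) = fun p => deriv G (p 1) := by
  funext p
  simp [pd2, (hasFDerivAt_separated hF hG p).fderiv]

theorem pd2_zero_zero_separated {F G : ℝ → ℝ} (hF : Differentiable ℝ F)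
    (hF' : Differentiable ℝ (deriv F)) (hG : Differentiable ℝ G) :
    pd2 0 (pd2 0 fun q => F (q 0) + G (q 1)) = fun p => deriv (deriv F) (p 0) := by
  rw [pd2_zero_separated hF hG]
  simpa using pd2_zero_separated hF' (differentiable_const (0 : ℝ))

theorem pd2_one_one_separated {F G : ℝ → ℝ} (hF : Differentiable ℝ F)
    (hG : Differentiable ℝ G) (hG' : Differentiable ℝ (deriv G)) :
    pd2 1 (pd2 1 fun q => F (q 0) + G (q 1)) = fun p => deriv (deriv G) (p 1) := by
  rw [pd2_one_separated hF hG]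
  simpa using pd2_one_separated (differentiable_const (0 : ℝ)) hG'

/-- A smooth function vanishing exactly on `(-∞, 1]` whose second derivative is small
on `[-2, 2]`. -/
theorem exists_smooth_flat_small_deriv_two :
    ∃ h : ℝ → ℝ, ContDiff ℝ (⊤ : ℕ∞) h ∧ (∀ x ≤ 1, h x = 0) ∧ (∀ x, 1 < x → h x ≠ 0) ∧
      ∀ x ∈ Set.Icc (-2 : ℝ) 2, |deriv (deriv h) x| < 1 := by
  let k : ℝ → ℝ := fun x => expNegInvGlue (x - 1)
  have hk : ContDiff ℝ (⊤ : ℕ∞) k := expNegInvGlue.contDiff.comp (contDiff_id.sub contDiff_const)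
  have hk' : ContDiff ℝ (⊤ : ℕ∞) (deriv k) := (contDiff_infty_iff_deriv.mp hk).2
  have hk'' : ContDiff ℝ (⊤ : ℕ∞) (deriv (deriv k)) := (contDiff_infty_iff_deriv.mp hk').2
  obtain ⟨M, hM⟩ := isCompact_Icc.exists_bound_of_continuousOn (s := Set.Icc (-2 : ℝ) 2)
    hk''.continuous.continuousOn
  have hM0 : 0 ≤ M := (norm_nonneg _).trans (hM 0 (by norm_num))
  refine ⟨fun x => (M + 1)⁻¹ * k x, contDiff_const.mul hk, fun x hx => ?_, fun x hx => ?_,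
    fun x hx => ?_⟩
  · simp [k, expNegInvGlue.zero_of_nonpos (sub_nonpos.mpr hx)]
  · exact (mul_pos (by positivity) (expNegInvGlue.pos_of_pos (sub_pos.mpr hx))).ne'
  · have h₁ : deriv (fun x => (M + 1)⁻¹ * k x) = fun x => (M + 1)⁻¹ * deriv k x :=
      deriv_const_mul_field' _
    have h₂ : deriv (fun x => (M + 1)⁻¹ * deriv k x) = fun x => (M + 1)⁻¹ * deriv (deriv k) x :=
      deriv_const_mul_field' _
    rw [h₁, h₂, abs_mul, abs_of_pos (by positivity), inv_mul_lt_one₀ (by positivity)]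
    exact (hM x hx).trans_lt (lt_add_one M)

/-- Failure of the WUCP for determinants of matrix solutions of the elliptic
operator `L = a∂₁² + b∂₂² + c∂₁ + d∂₂` in dimension 2. -/
theorem stmt_6 :
    ∃ ε : ℝ, 0 < ε ∧
    ∃ a b c d f₁ f₂ f₃ : EuclideanSpace ℝ (Fin 2) → ℝ,
      ContDiffOn ℝ (⊤ : ℕ∞) a (Metric.ball 0 (2*ε)) ∧
      ContDiffOn ℝ (⊤ : ℕ∞) b (Metric.ball 0 (2*ε)) ∧
      ContDiffOn ℝ (⊤ : ℕ∞) c (Metric.ball 0 (2*ε)) ∧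
      ContDiffOn ℝ (⊤ : ℕ∞) d (Metric.ball 0 (2*ε)) ∧
      ContDiffOn ℝ (⊤ : ℕ∞) f₁ (Metric.ball 0 (2*ε)) ∧
      ContDiffOn ℝ (⊤ : ℕ∞) f₂ (Metric.ball 0 (2*ε)) ∧
      ContDiffOn ℝ (⊤ : ℕ∞) f₃ (Metric.ball 0 (2*ε)) ∧
      (∀ p ∈ Metric.ball (0 : EuclideanSpace ℝ (Fin 2)) (2*ε), 0 < a p ∧ 0 < b p) ∧
      (∀ f ∈ ({f₁, f₂, f₃} : Set (EuclideanSpace ℝ (Fin 2) → ℝ)),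
        ∀ p ∈ Metric.ball (0 : EuclideanSpace ℝ (Fin 2)) (2*ε),
          a p * pd2 0 (pd2 0 f) p + b p * pd2 1 (pd2 1 f) p
            + c p * pd2 0 f p + d p * pd2 1 f p = 0) ∧
      (∀ p ∈ Metric.ball (0 : EuclideanSpace ℝ (Fin 2)) ε, f₁ p * f₂ p = f₃ p) ∧
      (∃ p ∈ Metric.ball (0 : EuclideanSpace ℝ (Fin 2)) (2*ε) \ Metric.ball 0 ε,
        f₁ p * f₂ p ≠ f₃ p) ∧
      (∀ p ∈ Metric.ball (0 : EuclideanSpace ℝ (Fin 2)) ε,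
        Matrix.det !![f₃ p, f₂ p; f₁ p, 1] = 0) ∧
      (∃ p ∈ Metric.ball (0 : EuclideanSpace ℝ (Fin 2)) (2*ε),
        Matrix.det !![f₃ p, f₂ p; f₁ p, 1] ≠ 0) := by
  obtain ⟨h, hh, h_zero, h_ne, h_small⟩ := exists_smooth_flat_small_deriv_two
  have hh' : ContDiff ℝ (⊤ : ℕ∞) (deriv h) := (contDiff_infty_iff_deriv.mp hh).2
  have hh'' : ContDiff ℝ (⊤ : ℕ∞) (deriv (deriv h)) := (contDiff_infty_iff_deriv.mp hh').2
  have hdh : Differentiable ℝ h := hh.differentiable (by simp)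
  have hdh' : Differentiable ℝ (deriv h) := hh'.differentiable (by simp)
  have coord (i : Fin 2) : ContDiff ℝ (⊤ : ℕ∞) (fun p : EuclideanSpace ℝ (Fin 2) => p i) :=
    (EuclideanSpace.proj i : EuclideanSpace ℝ (Fin 2) →L[ℝ] ℝ).contDiff
  have abs_coord_lt {r : ℝ} {p : EuclideanSpace ℝ (Fin 2)} (hp : p ∈ Metric.ball 0 r) :
      |p 0| < r :=
    (PiLp.norm_apply_le p 0).trans_lt (mem_ball_zero_iff.mp hp)
  have hF₁ : deriv (fun x => x ^ 2 + h x) = fun x => 2 * x + deriv h x := by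
    funext x
    simpa using ((hasDerivAt_pow 2 x).fun_add (hdh x).hasDerivAt).deriv
  have hF₂ : deriv (fun x => 2 * x + deriv h x) = fun x => 2 + deriv (deriv h) x := by
    funext x
    simpa using (((hasDerivAt_id x).const_mul 2).fun_add (hdh' x).hasDerivAt).deriv
  have hG₁ : deriv (fun y : ℝ => -y ^ 2) = fun y => -2 * y := by
    funext y
    simp
  have hG₂ : deriv (fun y : ℝ => -2 * y) = fun _ => -2 := by
    funext y
    simp
  have eq_on (p : EuclideanSpace ℝ (Fin 2)) (hp : p ∈ Metric.ball 0 1) :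
      (p 0 + p 1) * (p 0 + -p 1) = p 0 ^ 2 + h (p 0) + -p 1 ^ 2 := by
    rw [h_zero _ (abs_lt.mp (abs_coord_lt hp)).2.le]
    ring
  have norm_q : ‖EuclideanSpace.single (0 : Fin 2) (3 / 2 : ℝ)‖ = 3 / 2 := by norm_num
  have h_q : h (3 / 2) ≠ 0 := h_ne _ (by norm_num)
  refine ⟨1, one_pos, fun _ => 2, fun p => 2 + deriv (deriv h) (p 0), fun _ => 0, fun _ => 0,
    fun p => p 0 + p 1, fun p => p 0 + -p 1, fun p => p 0 ^ 2 + h (p 0) + -p 1 ^ 2,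
    contDiffOn_const, (contDiff_const.add (hh''.comp (coord 0))).contDiffOn, contDiffOn_const,
    contDiffOn_const, ((coord 0).add (coord 1)).contDiffOn, ((coord 0).add (coord 1).neg).contDiffOn,
    ((((coord 0).pow 2).add (hh.comp (coord 0))).add ((coord 1).pow 2).neg).contDiffOn,
    fun p hp => ⟨two_pos, ?_⟩, ?_, eq_on,
    ⟨EuclideanSpace.single 0 (3 / 2), ?_, ?_⟩, fun p hp => ?_,
    ⟨EuclideanSpace.single 0 (3 / 2), ?_, ?_⟩⟩
  · have hx := abs_lt.mp (abs_coord_lt hp)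
    have := abs_lt.mp (h_small (p 0) ⟨by linarith, by linarith⟩)
    linarith
  · rintro f (rfl | rfl | rfl) p -
    · rw [pd2_zero_zero_separated (F := fun x => x) (G := fun y => y) (by fun_prop) (by simp)
          (by fun_prop),
        pd2_one_one_separated (F := fun x => x) (G := fun y => y) (by fun_prop) (by fun_prop)
          (by simp)]
      simp
    · rw [pd2_zero_zero_separated (F := fun x => x) (G := fun y => -y) (by fun_prop) (by simp)
          (by fun_prop),
        pd2_one_one_separated (F := fun x => x) (G := fun y => -y) (by fun_prop) (by fun_prop)
          (by simp)]
      simp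
    · rw [pd2_zero_zero_separated (F := fun x => x ^ 2 + h x) (G := fun y => -y ^ 2)
          (by fun_prop) (by rw [hF₁]; fun_prop) (by fun_prop),
        pd2_one_one_separated (F := fun x => x ^ 2 + h x) (G := fun y => -y ^ 2)
          (by fun_prop) (by fun_prop) (by rw [hG₁]; fun_prop), hF₁, hF₂, hG₁, hG₂]
      ring
  · simp only [Set.mem_sdiff, mem_ball_zero_iff, norm_q]
    norm_num
  · simpa [pow_two] using h_q
  · rw [Matrix.det_fin_two_of]
    linarith [eq_on p hp]
  · rw [mem_ball_zero_iff, norm_q]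
    norm_num
  · simpa [Matrix.det_fin_two_of, pow_two] using h_q
end

section
/- Let Ω ⊂ ℝⁿ be open, let A = (aⁱʲ) be a smooth symmetric matrix function on Ω, let b = (bⁱ) and C = (cⁱ) be smooth vector functions, and let d be a smooth scalar function. Define the operator ℒu = −∂_i(aⁱʲ∂_j u + bⁱu) + cⁱ∂_i u + du and its formal adjoint ℒ*ψ = −∂_i(aⁱʲ∂_j ψ + cⁱψ) + bⁱ∂_i ψ + dψ (summation over repeated indices). If φ, ψ are smooth on Ω with ℒφ = 0, ℒ*ψ = 0, and ψ nowhere vanishing, then v = φ/ψ satisfies −∂_i(ψ²(aⁱʲ∂_j v + (bⁱ − cⁱ)v)) = 0 on Ω. -/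
/-- Partial derivative in the `i`-th coordinate direction on `ℝⁿ`. -/
noncomputable def pdn {n : ℕ} (i : Fin n) (f : EuclideanSpace ℝ (Fin n) → ℝ)
    (p : EuclideanSpace ℝ (Fin n)) : ℝ :=
  fderiv ℝ f p (EuclideanSpace.single i 1)

theorem pdn_congr_of_eqOn {n : ℕ} {Ω : Set (EuclideanSpace ℝ (Fin n))} (hΩ : IsOpen Ω)
    {f g : EuclideanSpace ℝ (Fin n) → ℝ} (h : Set.EqOn f g Ω) (i : Fin n)
    {p : EuclideanSpace ℝ (Fin n)} (hp : p ∈ Ω) : pdn i f p = pdn i g p := by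
  unfold pdn
  rw [(h.eventuallyEq_of_mem (hΩ.mem_nhds hp)).fderiv_eq]

theorem pdn_mul_sub_mul {n : ℕ} (i : Fin n) {f g h k : EuclideanSpace ℝ (Fin n) → ℝ}
    {p : EuclideanSpace ℝ (Fin n)} (hf : DifferentiableAt ℝ f p) (hg : DifferentiableAt ℝ g p)
    (hh : DifferentiableAt ℝ h p) (hk : DifferentiableAt ℝ k p) :
    pdn i (fun q => f q * g q - h q * k q) p
      = f p * pdn i g p + g p * pdn i f p - (h p * pdn i k p + k p * pdn i h p) := by
  unfold pdn
  rw [((hf.hasFDerivAt.fun_mul hg.hasFDerivAt).fun_sub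
    (hh.hasFDerivAt.fun_mul hk.hasFDerivAt)).fderiv]
  simp

theorem sq_mul_pdn_div {n : ℕ} (i : Fin n) {f g : EuclideanSpace ℝ (Fin n) → ℝ}
    {p : EuclideanSpace ℝ (Fin n)} (hf : DifferentiableAt ℝ f p) (hg : DifferentiableAt ℝ g p)
    (hp : g p ≠ 0) :
    g p ^ 2 * pdn i (fun q => f q / g q) p = g p * pdn i f p - f p * pdn i g p := by
  unfold pdn
  simp only [div_eq_mul_inv]
  have hinv : HasFDerivAt (fun q => (g q)⁻¹) (-(g p ^ 2)⁻¹ • fderiv ℝ g p) p :=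
    (hasDerivAt_inv hp).comp_hasFDerivAt p hg.hasFDerivAt
  rw [(hf.hasFDerivAt.fun_mul hinv).fderiv]
  simp
  field_simp
  ring

theorem differentiableOn_pdn {n : ℕ} {Ω : Set (EuclideanSpace ℝ (Fin n))} (hΩ : IsOpen Ω)
    {f : EuclideanSpace ℝ (Fin n) → ℝ} (hf : ContDiffOn ℝ (⊤ : ℕ∞) f Ω) (i : Fin n) :
    DifferentiableOn ℝ (pdn i f) Ω :=
  ((hf.fderiv_of_isOpen (m := 1) hΩ (by norm_cast)).differentiableOn one_ne_zero).clm_apply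
    (differentiableOn_const _)

/-- Reduction lemma: if `ℒφ = 0`, `ℒ*ψ = 0` with `ψ` nowhere vanishing, where
`ℒu = −∂_i(aⁱʲ∂_j u + bⁱu) + cⁱ∂_i u + du`, then `v = φ/ψ` satisfies
`−∂_i(ψ²(aⁱʲ∂_j v + (bⁱ − cⁱ)v)) = 0`. -/
theorem stmt_7 (n : ℕ) (Ω : Set (EuclideanSpace ℝ (Fin n))) (hΩ : IsOpen Ω)
    (a : Fin n → Fin n → EuclideanSpace ℝ (Fin n) → ℝ)
    (b c : Fin n → EuclideanSpace ℝ (Fin n) → ℝ)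
    (d : EuclideanSpace ℝ (Fin n) → ℝ)
    (ha : ∀ i j, ContDiffOn ℝ (⊤ : ℕ∞) (a i j) Ω)
    (hsym : ∀ i j, ∀ p ∈ Ω, a i j p = a j i p)
    (hb : ∀ i, ContDiffOn ℝ (⊤ : ℕ∞) (b i) Ω)
    (hc : ∀ i, ContDiffOn ℝ (⊤ : ℕ∞) (c i) Ω)
    (hd : ContDiffOn ℝ (⊤ : ℕ∞) d Ω)
    (φ ψ : EuclideanSpace ℝ (Fin n) → ℝ)
    (hφ : ContDiffOn ℝ (⊤ : ℕ∞) φ Ω)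
    (hψ : ContDiffOn ℝ (⊤ : ℕ∞) ψ Ω)
    (hLφ : ∀ p ∈ Ω,
      -(∑ i, pdn i (fun q => (∑ j, a i j q * pdn j φ q) + b i q * φ q) p)
        + (∑ i, c i p * pdn i φ p) + d p * φ p = 0)
    (hLψ : ∀ p ∈ Ω,
      -(∑ i, pdn i (fun q => (∑ j, a i j q * pdn j ψ q) + c i q * ψ q) p)
        + (∑ i, b i p * pdn i ψ p) + d p * ψ p = 0)
    (hψ0 : ∀ p ∈ Ω, ψ p ≠ 0) :
    ∀ p ∈ Ω,
      -(∑ i, pdn i (fun q => ψ q ^ 2 *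
          ((∑ j, a i j q * pdn j (fun z => φ z / ψ z) q)
            + (b i q - c i q) * (φ q / ψ q))) p) = 0 := by
  have diff : ∀ {f : EuclideanSpace ℝ (Fin n) → ℝ}, ContDiffOn ℝ (⊤ : ℕ∞) f Ω →
      ∀ q ∈ Ω, DifferentiableAt ℝ f q := fun hf q hq =>
    (hf.differentiableOn (by simp)).differentiableAt (hΩ.mem_nhds hq)
  have diffFlux : ∀ {f : EuclideanSpace ℝ (Fin n) → ℝ} {e : Fin n → EuclideanSpace ℝ (Fin n) → ℝ},
      ContDiffOn ℝ (⊤ : ℕ∞) f Ω → (∀ i, ContDiffOn ℝ (⊤ : ℕ∞) (e i) Ω) → ∀ i, ∀ q ∈ Ω,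
      DifferentiableAt ℝ (fun q => (∑ j, a i j q * pdn j f q) + e i q * f q) q := by
    intro f e hf he i q hq
    refine DifferentiableAt.fun_add (DifferentiableAt.fun_sum fun j _ => ?_)
      ((diff (he i) q hq).fun_mul (diff hf q hq))
    exact (diff (ha i j) q hq).fun_mul
      ((differentiableOn_pdn hΩ hf j).differentiableAt (hΩ.mem_nhds hq))
  intro p hp
  have flux : ∀ i, Set.EqOn
      (fun q => ψ q ^ 2 * ((∑ j, a i j q * pdn j (fun z => φ z / ψ z) q)
        + (b i q - c i q) * (φ q / ψ q)))
      (fun q => ψ q * ((∑ j, a i j q * pdn j φ q) + b i q * φ q)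
        - φ q * ((∑ j, a i j q * pdn j ψ q) + c i q * ψ q)) Ω := by
    intro i q hq
    have h0 := hψ0 q hq
    have hsum : ψ q ^ 2 * (∑ j, a i j q * pdn j (fun z => φ z / ψ z) q)
        = ψ q * (∑ j, a i j q * pdn j φ q) - φ q * (∑ j, a i j q * pdn j ψ q) := by
      simp only [Finset.mul_sum, ← Finset.sum_sub_distrib]
      refine Finset.sum_congr rfl fun j _ => ?_
      linear_combination a i j q * sq_mul_pdn_div j (diff hφ q hq) (diff hψ q hq) h0
    have hdiv : ψ q ^ 2 * (φ q / ψ q) = ψ q * φ q := by field_simp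
    dsimp only
    linear_combination hsum + (b i q - c i q) * hdiv
  have symm_form : ∑ i, (∑ j, a i j p * pdn j φ p) * pdn i ψ p
      = ∑ i, (∑ j, a i j p * pdn j ψ p) * pdn i φ p := by
    simp only [Finset.sum_mul]
    rw [Finset.sum_comm]
    refine Finset.sum_congr rfl fun i _ => Finset.sum_congr rfl fun j _ => ?_
    rw [hsym j i p hp]
    ring
  have expand : ∀ i, pdn i (fun q => ψ q ^ 2 *
      ((∑ j, a i j q * pdn j (fun z => φ z / ψ z) q) + (b i q - c i q) * (φ q / ψ q))) p
      = ψ p * pdn i (fun q => (∑ j, a i j q * pdn j φ q) + b i q * φ q) p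
        - φ p * pdn i (fun q => (∑ j, a i j q * pdn j ψ q) + c i q * ψ q) p
        + (∑ j, a i j p * pdn j φ p) * pdn i ψ p
        - (∑ j, a i j p * pdn j ψ p) * pdn i φ p
        + φ p * (b i p * pdn i ψ p) - ψ p * (c i p * pdn i φ p) := by
    intro i
    rw [pdn_congr_of_eqOn hΩ (flux i) i hp, pdn_mul_sub_mul i (diff hψ p hp)
      (diffFlux hφ hb i p hp) (diff hφ p hp) (diffFlux hψ hc i p hp)]
    ring
  simp only [expand, Finset.sum_add_distrib, Finset.sum_sub_distrib, ← Finset.mul_sum]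
  linear_combination ψ p * hLφ p hp - φ p * hLψ p hp - symm_form
end

section
/- There exist ε > 0, smooth positive functions α, β : B_{2ε} → ℝ on the ball B_{2ε} ⊂ ℝ² centered at 0, smooth functions b¹, b² : B_{2ε} → ℝ, and smooth functions g₁, g₂, g₃, g₄ : B_{2ε} → ℝ with g₄ nowhere vanishing, such that each of g₁, g₂, g₃, g₄ solves the divergence-type equation −∂₁(α ∂₁u + b¹u) − ∂₂(β ∂₂u + b²u) = 0 on B_{2ε}, and the matrix G = [[g₃, g₂],[g₁, g₄]] satisfies det G = 0 on B_ε but det G ≠ 0 at some point of B_{2ε} \ B_ε. Hence the weak unique continuation property for determinants of matrix solutions fails for elliptic operators of divergence type with a zero-order term under the divergence sign, of the form −∂_i(aⁱʲ∂_j u + bⁱu) with (aⁱʲ) diagonal and positive definite. -/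
/-- The function `(x, y) ↦ a x + y * c x` on the plane. -/
noncomputable def affineInSnd (a c : ℝ → ℝ) (q : EuclideanSpace ℝ (Fin 2)) : ℝ :=
  a (q 0) + q 1 * c (q 0)

theorem contDiff_affineInSnd {a c : ℝ → ℝ} {n : WithTop ℕ∞} (ha : ContDiff ℝ n a)
    (hc : ContDiff ℝ n c) : ContDiff ℝ n (affineInSnd a c) := by
  have h (i : Fin 2) : ContDiff ℝ n fun q : EuclideanSpace ℝ (Fin 2) => q i :=
    (EuclideanSpace.proj (𝕜 := ℝ) i).contDiff
  exact (ha.comp (h 0)).add ((h 1).mul (hc.comp (h 0)))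

theorem hasFDerivAt_affineInSnd {a c : ℝ → ℝ} {a' c' : ℝ} {p : EuclideanSpace ℝ (Fin 2)}
    (ha : HasDerivAt a a' (p 0)) (hc : HasDerivAt c c' (p 0)) :
    HasFDerivAt (affineInSnd a c)
      (a' • EuclideanSpace.proj (𝕜 := ℝ) 0 +
        (p 1 • c' • EuclideanSpace.proj (𝕜 := ℝ) 0 +
          c (p 0) • EuclideanSpace.proj (𝕜 := ℝ) 1)) p := by
  have h (i : Fin 2) : HasFDerivAt (fun q : EuclideanSpace ℝ (Fin 2) => q i)
      (EuclideanSpace.proj (𝕜 := ℝ) i) p :=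
    (EuclideanSpace.proj (𝕜 := ℝ) i).hasFDerivAt
  exact (ha.comp_hasFDerivAt p (h 0)).add ((h 1).mul (hc.comp_hasFDerivAt p (h 0)))

theorem pd2_zero_affineInSnd {a c a' c' : ℝ → ℝ} (ha : ∀ x, HasDerivAt a (a' x) x)
    (hc : ∀ x, HasDerivAt c (c' x) x) :
    pd2 0 (affineInSnd a c) = affineInSnd a' c' := by
  ext p
  rw [pd2, (hasFDerivAt_affineInSnd (ha _) (hc _)).fderiv]
  simp [affineInSnd]

theorem pd2_one_affineInSnd {a c a' c' : ℝ → ℝ} (ha : ∀ x, HasDerivAt a (a' x) x)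
    (hc : ∀ x, HasDerivAt c (c' x) x) :
    pd2 1 (affineInSnd a c) = affineInSnd c 0 := by
  ext p
  rw [pd2, (hasFDerivAt_affineInSnd (ha _) (hc _)).fderiv]
  simp [affineInSnd]

/-- An affine function of `y` solves `-Δu + ∂₂(B(x) u) = 0` as soon as its coefficients satisfy
`a'' = B c` and `c'' = 0`. -/
theorem divergence_affineInSnd_eq_zero {a c a' c' B B' : ℝ → ℝ}
    (ha : ∀ x, HasDerivAt a (a' x) x) (hc : ∀ x, HasDerivAt c (c' x) x)
    (hB : ∀ x, HasDerivAt B (B' x) x) (ha' : ∀ x, HasDerivAt a' (B x * c x) x)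
    (hc' : ∀ x, HasDerivAt c' 0 x) (p : EuclideanSpace ℝ (Fin 2)) :
    -(pd2 0 (fun q => 1 * pd2 0 (affineInSnd a c) q + 0 * affineInSnd a c q) p)
      - pd2 1 (fun q => 1 * pd2 1 (affineInSnd a c) q + -B (q 0) * affineInSnd a c q) p = 0 := by
  have h0 : (fun q => 1 * pd2 0 (affineInSnd a c) q + 0 * affineInSnd a c q)
      = affineInSnd a' c' := by
    ext q
    rw [pd2_zero_affineInSnd ha hc]
    ring
  have h1 : (fun q => 1 * pd2 1 (affineInSnd a c) q + -B (q 0) * affineInSnd a c q)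
      = affineInSnd (c - B * a) (-(B * c)) := by
    ext q
    rw [pd2_one_affineInSnd ha hc]
    simp only [affineInSnd, Pi.zero_apply, Pi.sub_apply, Pi.mul_apply, Pi.neg_apply]
    ring
  rw [h0, h1, pd2_zero_affineInSnd ha' hc',
    pd2_one_affineInSnd (fun x => (hc x).sub ((hB x).mul (ha x)))
      (fun x => ((hB x).mul (hc x)).neg)]
  simp [affineInSnd]

theorem ContDiff.exists_hasDerivAt {f : ℝ → ℝ} (hf : ContDiff ℝ (⊤ : ℕ∞) f) :
    ∃ f' : ℝ → ℝ, ContDiff ℝ (⊤ : ℕ∞) f' ∧ ∀ x, HasDerivAt f (f' x) x :=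
  ⟨deriv f, (contDiff_infty_iff_deriv.1 hf).2,
    fun x => ((contDiff_infty_iff_deriv.1 hf).1 x).hasDerivAt⟩

/-- Failure of the WUCP for determinants of matrix solutions of divergence-type
operators `−∂₁(α∂₁u + b¹u) − ∂₂(β∂₂u + b²u)` with diagonal positive definite
principal part, in dimension 2. -/
theorem stmt_8 :
    ∃ ε : ℝ, 0 < ε ∧
    ∃ α β b1 b2 g₁ g₂ g₃ g₄ : EuclideanSpace ℝ (Fin 2) → ℝ,
      ContDiffOn ℝ (⊤ : ℕ∞) α (Metric.ball 0 (2*ε)) ∧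
      ContDiffOn ℝ (⊤ : ℕ∞) β (Metric.ball 0 (2*ε)) ∧
      ContDiffOn ℝ (⊤ : ℕ∞) b1 (Metric.ball 0 (2*ε)) ∧
      ContDiffOn ℝ (⊤ : ℕ∞) b2 (Metric.ball 0 (2*ε)) ∧
      ContDiffOn ℝ (⊤ : ℕ∞) g₁ (Metric.ball 0 (2*ε)) ∧
      ContDiffOn ℝ (⊤ : ℕ∞) g₂ (Metric.ball 0 (2*ε)) ∧
      ContDiffOn ℝ (⊤ : ℕ∞) g₃ (Metric.ball 0 (2*ε)) ∧
      ContDiffOn ℝ (⊤ : ℕ∞) g₄ (Metric.ball 0 (2*ε)) ∧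
      (∀ p ∈ Metric.ball (0 : EuclideanSpace ℝ (Fin 2)) (2*ε), 0 < α p ∧ 0 < β p) ∧
      (∀ p ∈ Metric.ball (0 : EuclideanSpace ℝ (Fin 2)) (2*ε), g₄ p ≠ 0) ∧
      (∀ g ∈ ({g₁, g₂, g₃, g₄} : Set (EuclideanSpace ℝ (Fin 2) → ℝ)),
        ∀ p ∈ Metric.ball (0 : EuclideanSpace ℝ (Fin 2)) (2*ε),
          -(pd2 0 (fun q => α q * pd2 0 g q + b1 q * g q) p)
            - pd2 1 (fun q => β q * pd2 1 g q + b2 q * g q) p = 0) ∧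
      (∀ p ∈ Metric.ball (0 : EuclideanSpace ℝ (Fin 2)) ε,
        Matrix.det !![g₃ p, g₂ p; g₁ p, g₄ p] = 0) ∧
      (∃ p ∈ Metric.ball (0 : EuclideanSpace ℝ (Fin 2)) (2*ε) \ Metric.ball 0 ε,
        Matrix.det !![g₃ p, g₂ p; g₁ p, g₄ p] ≠ 0) := by
  have hF : ContDiff ℝ (⊤ : ℕ∞) fun x : ℝ => expNegInvGlue (x - 1) :=
    expNegInvGlue.contDiff.comp (contDiff_id.sub contDiff_const)
  obtain ⟨f, hf, hFf⟩ := hF.exists_hasDerivAt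
  obtain ⟨f₁, hf₁, hff₁⟩ := hf.exists_hasDerivAt
  obtain ⟨f₂, hf₂, hff₂⟩ := hf₁.exists_hasDerivAt
  obtain ⟨f₃, -, hff₃⟩ := hf₂.exists_hasDerivAt
  have hid : ContDiff ℝ (⊤ : ℕ∞) fun x : ℝ => x := contDiff_id
  have hdet (p : EuclideanSpace ℝ (Fin 2)) :
      Matrix.det !![affineInSnd (fun x => x * f x - 2 * expNegInvGlue (x - 1)) (fun x => x) p,
        affineInSnd (fun x => x) (fun _ => 0) p;
        affineInSnd f (fun _ => 1) p, affineInSnd (fun _ => 1) (fun _ => 0) p]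
        = -2 * expNegInvGlue (p 0 - 1) := by
    rw [Matrix.det_fin_two_of]
    simp only [affineInSnd]
    ring
  refine ⟨1, one_pos, fun _ => 1, fun _ => 1, fun _ => 0, fun q => -f₂ (q 0),
    affineInSnd f (fun _ => 1), affineInSnd (fun x => x) (fun _ => 0),
    affineInSnd (fun x => x * f x - 2 * expNegInvGlue (x - 1)) (fun x => x),
    affineInSnd (fun _ => 1) (fun _ => 0),
    contDiffOn_const, contDiffOn_const, contDiffOn_const,
    (hf₂.comp (EuclideanSpace.proj (𝕜 := ℝ) (0 : Fin 2)).contDiff).neg.contDiffOn,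
    (contDiff_affineInSnd hf contDiff_const).contDiffOn,
    (contDiff_affineInSnd hid contDiff_const).contDiffOn,
    (contDiff_affineInSnd ((hid.mul hf).sub (contDiff_const.mul hF)) hid).contDiffOn,
    (contDiff_affineInSnd contDiff_const contDiff_const).contDiffOn,
    fun _ _ => ⟨one_pos, one_pos⟩, fun p _ => by simp [affineInSnd], ?_, ?_, ?_⟩
  · rintro g (rfl | rfl | rfl | rfl) p -
    · exact divergence_affineInSnd_eq_zero hff₁ (fun x => hasDerivAt_const x 1) hff₃
        (by simpa using hff₂) (fun x => hasDerivAt_const x 0) p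
    · exact divergence_affineInSnd_eq_zero hasDerivAt_id' (fun x => hasDerivAt_const x 0) hff₃
        (fun x => by simpa using hasDerivAt_const x (1 : ℝ)) (fun x => hasDerivAt_const x 0) p
    · refine divergence_affineInSnd_eq_zero (a' := fun x => x * f₁ x - f x) (fun x => ?_)
        hasDerivAt_id' hff₃ (fun x => ?_) (fun x => hasDerivAt_const x 1) p
      · exact (((hasDerivAt_id' x).mul (hff₁ x)).sub ((hFf x).const_mul 2)).congr_deriv (by ring)
      · exact (((hasDerivAt_id' x).mul (hff₂ x)).sub (hff₁ x)).congr_deriv (by ring)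
    · exact divergence_affineInSnd_eq_zero (fun x => hasDerivAt_const x 1)
        (fun x => hasDerivAt_const x 0) hff₃
        (fun x => by simpa using hasDerivAt_const x (0 : ℝ)) (fun x => hasDerivAt_const x 0) p
  · intro p hp
    have hp0 : p 0 ≤ 1 :=
      (le_abs_self _).trans ((PiLp.norm_apply_le p 0).trans (mem_ball_zero_iff.1 hp).le)
    rw [hdet, expNegInvGlue.zero_of_nonpos (by linarith), mul_zero]
  · refine ⟨EuclideanSpace.single 0 (3 / 2), ?_, ?_⟩
    · simp only [Set.mem_sdiff, mem_ball_zero_iff, PiLp.norm_single]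
      norm_num
    · rw [hdet]
      have hpos : 0 < expNegInvGlue ((3 / 2 : ℝ) - 1) :=
        expNegInvGlue.pos_of_pos (by norm_num)
      simpa using hpos.ne'
end

section
/- Let m ∈ ℕ, let a : ℝ → ℝ be smooth and positive, and let F : ℝ → ℂ^{m×m} be a smooth matrix function satisfying (d/dt)(a(t) · dF/dt(t)) = 0 entrywise for all t ∈ ℝ. If all derivatives of det F of order ≤ m vanish at 0 (i.e. det F vanishes to order m+1 at 0), then det F = 0 identically on ℝ. In particular both the strong and weak unique continuation properties hold for det F. -/
open Polynomial in
/-- If `G` is smooth with `G' = b⁻¹`, `G 0 = 0`, and all derivatives of order at most `n` of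
`p ∘ G` vanish at `0`, then the coefficients of `p` of order at most `n` vanish. -/
theorem coeff_eq_zero_of_iteratedDeriv_eval_comp_eq_zero {G b : ℝ → ℂ}
    (hG : ContDiff ℝ (⊤ : ℕ∞) G) (hb : ContDiff ℝ (⊤ : ℕ∞) b) (hb0 : ∀ t, b t ≠ 0)
    (hGb : ∀ t, HasDerivAt G (b t)⁻¹ t) (hG0 : G 0 = 0) (n : ℕ) (p : ℂ[X])
    (h : ∀ k ≤ n, iteratedDeriv k (fun t => p.eval (G t)) 0 = 0) :
    ∀ k ≤ n, p.coeff k = 0 := by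
  have h0 : p.coeff 0 = 0 := by
    have := h 0 (Nat.zero_le n)
    simpa [hG0, coeff_zero_eq_eval_zero] using this
  induction n generalizing p with
  | zero =>
    intro k hk
    rwa [Nat.le_zero.mp hk]
  | succ n ih =>
    have hpG : ContDiff ℝ (⊤ : ℕ∞) (fun t => p.eval (G t)) := by
      simpa [Function.comp_def] using
        ((p.contDiff_aeval (𝕜 := ℂ) (⊤ : ℕ∞)).restrict_scalars ℝ).comp hG
    have hd : ContDiff ℝ (⊤ : ℕ∞) (deriv fun t => p.eval (G t)) :=
      (contDiff_infty_iff_deriv.mp hpG).2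
    have hderiv : (fun t => (derivative p).eval (G t)) =
        b * deriv fun t => p.eval (G t) := by
      funext t
      have : HasDerivAt (fun t => p.eval (G t)) ((derivative p).eval (G t) * (b t)⁻¹) t :=
        (p.hasDerivAt (G t)).comp t (hGb t)
      rw [Pi.mul_apply, this.deriv]
      field_simp [hb0 t]
    have hvan : ∀ k ≤ n, iteratedDeriv k (fun t => (derivative p).eval (G t)) 0 = 0 := by
      intro k hk
      rw [hderiv, iteratedDeriv_mul (hb.contDiffAt.of_le (by exact_mod_cast le_top))
        (hd.contDiffAt.of_le (by exact_mod_cast le_top))]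
      refine Finset.sum_eq_zero fun i _ => ?_
      rw [← iteratedDeriv_succ', h _ (by omega), mul_zero]
    have hder := ih (derivative p) hvan (by
      have := hvan 0 (Nat.zero_le n)
      simpa [hG0, coeff_zero_eq_eval_zero] using this)
    intro k hk
    cases k with
    | zero => exact h0
    | succ k =>
      have := hder k (by omega)
      rw [coeff_derivative] at this
      exact (mul_eq_zero.mp this).resolve_right (by exact_mod_cast Nat.succ_ne_zero k)

/-- SUCP for determinants of matrix solutions of `(d/dt)(a·dF/dt) = 0` in one
dimension: if `det F` vanishes to order `m+1` at `0` then `det F ≡ 0`. -/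
theorem stmt_9 (m : ℕ) (a : ℝ → ℝ)
    (ha : ContDiff ℝ (⊤ : ℕ∞) a) (hapos : ∀ t, 0 < a t)
    (F : ℝ → Matrix (Fin m) (Fin m) ℂ)
    (hF : ∀ i j, ContDiff ℝ (⊤ : ℕ∞) (fun t => F t i j))
    (heq : ∀ i j, ∀ t : ℝ,
      deriv (fun s => (a s : ℂ) * deriv (fun u => F u i j) s) t = 0)
    (hvan : ∀ k ≤ m, deriv^[k] (fun t => (F t).det) 0 = 0) :
    ∀ t : ℝ, (F t).det = 0 := by
  have hb : ContDiff ℝ (⊤ : ℕ∞) (fun t => (a t : ℂ)) := Complex.ofRealCLM.contDiff.comp ha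
  have hb0 : ∀ t, (a t : ℂ) ≠ 0 := fun t => by exact_mod_cast (hapos t).ne'
  have hbinv : ContDiff ℝ (⊤ : ℕ∞) (fun t => (a t : ℂ)⁻¹) := hb.inv hb0
  set G : ℝ → ℂ := fun t => ∫ s in (0 : ℝ)..t, (a s : ℂ)⁻¹ with hGdef
  have hGb : ∀ t, HasDerivAt G (a t : ℂ)⁻¹ t := fun t =>
    hbinv.continuous.integral_hasStrictDerivAt 0 t |>.hasDerivAt
  have hG0 : G 0 = 0 := by simp [hGdef]
  have hG : ContDiff ℝ (⊤ : ℕ∞) G := by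
    refine contDiff_infty_iff_deriv.mpr ⟨fun t => (hGb t).differentiableAt, ?_⟩
    rwa [show deriv G = fun t => (a t : ℂ)⁻¹ from funext fun t => (hGb t).deriv]
  let B : Matrix (Fin m) (Fin m) ℂ := fun i j => (a 0 : ℂ) * deriv (fun u => F u i j) 0
  have hFeq : ∀ t, F t = G t • B + F 0 := by
    intro t
    ext i j
    have hF' := contDiff_infty_iff_deriv.mp (hF i j)
    have hconst : ∀ s, (a s : ℂ) * deriv (fun u => F u i j) s = B i j := fun s =>
      is_const_of_deriv_eq_zero ((hb.mul hF'.2).differentiable (by simp)) (heq i j) s 0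
    have hd : ∀ s, HasDerivAt (fun u => F u i j - G u * B i j) 0 s := by
      intro s
      have h1 := (hF'.1 s).hasDerivAt.sub ((hGb s).mul_const (B i j))
      rw [show (a s : ℂ)⁻¹ * B i j = deriv (fun u => F u i j) s by
        rw [← hconst s, inv_mul_cancel_left₀ (hb0 s)], sub_self] at h1
      exact h1
    have h2 := is_const_of_deriv_eq_zero (fun s => (hd s).differentiableAt)
      (fun s => (hd s).deriv) t 0
    simp only [hG0, zero_mul, sub_zero] at h2
    simp [← h2]
  let p : Polynomial ℂ :=
    ((Polynomial.X : Polynomial ℂ) • B.map Polynomial.C + (F 0).map Polynomial.C).det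
  have hp : ∀ t, (F t).det = p.eval (G t) := by
    intro t
    rw [hFeq t, ← Polynomial.coe_evalRingHom, RingHom.map_det]
    congr 1
    ext i j
    simp [mul_comm (G t)]
  have hcoeff := coeff_eq_zero_of_iteratedDeriv_eval_comp_eq_zero hG hb hb0 hGb hG0 m p
    (fun k hk => by
      rw [iteratedDeriv_eq_iterate, ← funext hp]
      exact hvan k hk)
  have hp0 : p = 0 := by
    ext k
    rcases le_or_gt k m with hk | hk
    · simpa using hcoeff k hk
    · refine Polynomial.coeff_eq_zero_of_natDegree_lt (lt_of_le_of_lt ?_ hk)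
      simpa using Polynomial.natDegree_det_X_add_C_le B (F 0)
  intro t
  rw [hp t, hp0, Polynomial.eval_zero]
end

section
/- Let m ∈ ℕ, let a, b : ℝ → ℂ be smooth scalar functions, and let F : ℝ → ℂ^{m×m} be a smooth matrix function satisfying F''(t) + a(t)F'(t) + b(t)F(t) = 0 entrywise for all t ∈ ℝ. If all derivatives of det F of order ≤ m vanish at 0 (i.e. det F vanishes to order m+1 at 0), then det F = 0 identically on ℝ. In particular both the strong and weak unique continuation properties hold for det F. -/
open Filter Topology Asymptotics Set

/-- The `C²` solutions `ℝ → ℂ` of `f'' + a f' + b f = 0`. -/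
def secondOrderSolutions (a b : ℝ → ℂ) : Submodule ℂ (ℝ → ℂ) where
  carrier := {f | ContDiff ℝ 2 f ∧ ∀ t, deriv (deriv f) t + a t * deriv f t + b t * f t = 0}
  zero_mem' := by
    refine ⟨contDiff_const, fun t => ?_⟩
    simp
  add_mem' := by
    rintro f g ⟨hf, hf'⟩ ⟨hg, hg'⟩
    refine ⟨hf.add hg, fun t => ?_⟩
    have h1 : deriv (f + g) = deriv f + deriv g := by
      ext s
      exact deriv_add (hf.differentiable (by norm_num) s) (hg.differentiable (by norm_num) s)
    rw [h1, deriv_add (hf.differentiable_deriv_two t) (hg.differentiable_deriv_two t)]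
    simp only [Pi.add_apply]
    linear_combination hf' t + hg' t
  smul_mem' := by
    rintro c f ⟨hf, hf'⟩
    refine ⟨hf.const_smul c, fun t => ?_⟩
    have h1 : deriv (c • f) = c • deriv f := by
      ext s
      exact deriv_const_smul c (hf.differentiable (by norm_num) s)
    rw [h1, deriv_const_smul c (hf.differentiable_deriv_two t)]
    simp only [Pi.smul_apply, smul_eq_mul]
    linear_combination c * hf' t

theorem hasDerivAt_of_mem_secondOrderSolutions {a b f : ℝ → ℂ}
    (hf : f ∈ secondOrderSolutions a b) (t : ℝ) : HasDerivAt f (deriv f t) t :=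
  (hf.1.differentiable (by norm_num) t).hasDerivAt

theorem eq_zero_of_mem_secondOrderSolutions {a b f : ℝ → ℂ} (ha : Continuous a)
    (hb : Continuous b) (hf : f ∈ secondOrderSolutions a b) {t₀ : ℝ} (h₀ : f t₀ = 0)
    (h₁ : deriv f t₀ = 0) : f = 0 := by
  ext t
  obtain ⟨A, B, ht, ht₀⟩ : ∃ A B, t ∈ Ioo A B ∧ t₀ ∈ Ioo A B :=
    ⟨min t t₀ - 1, max t t₀ + 1, by grind, by grind⟩
  obtain ⟨M, hM⟩ := (isCompact_Icc (a := A) (b := B)).exists_bound_of_continuousOn ha.continuousOn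
  obtain ⟨N, hN⟩ := (isCompact_Icc (a := A) (b := B)).exists_bound_of_continuousOn hb.continuousOn
  have hM0 : 0 ≤ M := (norm_nonneg _).trans (hM t (Ioo_subset_Icc_self ht))
  have hN0 : 0 ≤ N := (norm_nonneg _).trans (hN t (Ioo_subset_Icc_self ht))
  let v : ℝ → ℂ × ℂ → ℂ × ℂ := fun s p => (p.2, -(a s * p.2 + b s * p.1))
  have hv : ∀ s ∈ Ioo A B, LipschitzOnWith (1 + M + N).toNNReal (v s) univ := by
    intro s hs
    refine (LipschitzWith.of_dist_le_mul fun p q => ?_).lipschitzOnWith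
    rw [Real.coe_toNNReal _ (by positivity), dist_eq_norm, dist_eq_norm]
    have e : v s p - v s q = ((p - q).2, -(a s * (p - q).2 + b s * (p - q).1)) := by
      ext <;> simp [v]
      ring
    rw [e]
    generalize p - q = r
    have hr₁ := norm_fst_le r
    have hr₂ := norm_snd_le r
    have ha' := hM s (Ioo_subset_Icc_self hs)
    have hb' := hN s (Ioo_subset_Icc_self hs)
    rw [Prod.norm_mk, max_le_iff, norm_neg]
    constructor
    · nlinarith [norm_nonneg r]
    · calc ‖a s * r.2 + b s * r.1‖ ≤ ‖a s‖ * ‖r.2‖ + ‖b s‖ * ‖r.1‖ := by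
            simpa only [norm_mul] using norm_add_le (a s * r.2) (b s * r.1)
        _ ≤ M * ‖r‖ + N * ‖r‖ := by gcongr
        _ ≤ (1 + M + N) * ‖r‖ := by nlinarith [norm_nonneg r]
  have key : EqOn (fun s => (f s, deriv f s)) (fun _ => (0, 0)) (Ioo A B) := by
    refine ODE_solution_unique_of_mem_Ioo hv ht₀ (fun s _ => ⟨?_, mem_univ _⟩)
      (fun s _ => ⟨?_, mem_univ _⟩) (by simp [h₀, h₁])
    · have h2 := (hf.1.differentiable_deriv_two s).hasDerivAt
      have e : deriv (deriv f) s = -(a s * deriv f s + b s * f s) := by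
        linear_combination hf.2 s
      rw [e] at h2
      exact (hasDerivAt_of_mem_secondOrderSolutions hf s).prodMk h2
    · have e : v s (0, 0) = 0 := by simp [v]
      simpa only [e] using hasDerivAt_const s ((0, 0) : ℂ × ℂ)
  exact congrArg Prod.fst (key ht)

/-- Every solution is determined linearly, through solutions, by its Cauchy data at `t₀`. -/
theorem exists_eq_cauchyData_combination {a b : ℝ → ℂ} (ha : Continuous a) (hb : Continuous b)
    (t₀ : ℝ) :
    ∃ u ∈ secondOrderSolutions a b, ∃ v ∈ secondOrderSolutions a b,
      ∀ f ∈ secondOrderSolutions a b, ∀ t, f t = u t * f t₀ + v t * deriv f t₀ := by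
  let T : secondOrderSolutions a b →ₗ[ℂ] ℂ × ℂ :=
    { toFun := fun f => (f.1 t₀, deriv f.1 t₀)
      map_add' := fun f g => by
        have := (hasDerivAt_of_mem_secondOrderSolutions f.2 t₀).add
          (hasDerivAt_of_mem_secondOrderSolutions g.2 t₀)
        exact Prod.ext rfl this.deriv
      map_smul' := fun c f => by
        have := (hasDerivAt_of_mem_secondOrderSolutions f.2 t₀).const_smul c
        exact Prod.ext rfl this.deriv }
  have hT : LinearMap.ker T = ⊥ := by
    refine LinearMap.ker_eq_bot'.2 fun f hf => Subtype.ext ?_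
    exact eq_zero_of_mem_secondOrderSolutions ha hb f.2 (congrArg Prod.fst hf)
      (congrArg Prod.snd hf)
  obtain ⟨G, hG⟩ := T.exists_leftInverse_of_injective hT
  refine ⟨G (1, 0), (G (1, 0)).2, G (0, 1), (G (0, 1)).2, fun f hf t => ?_⟩
  have h1 : G (T ⟨f, hf⟩) = ⟨f, hf⟩ := LinearMap.congr_fun hG _
  have h2 : T ⟨f, hf⟩ = f t₀ • ((1, 0) : ℂ × ℂ) + deriv f t₀ • ((0, 1) : ℂ × ℂ) := by
    simp [T]
  rw [h2, map_add, map_smul, map_smul] at h1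
  have h3 := congrFun (congrArg Subtype.val h1) t
  simp only [Submodule.coe_add, Submodule.coe_smul, Pi.add_apply, Pi.smul_apply,
    smul_eq_mul] at h3
  rw [← h3]
  ring

theorem Matrix.det_smul_one_add_smul {n K : Type*} [Fintype n] [DecidableEq n] [Field K]
    [IsAlgClosed K] (N : Matrix n n K) (x y : K) :
    (x • (1 : Matrix n n K) + y • N).det = (N.charpoly.roots.map fun r => x + y * r).prod := by
  have hcard : N.charpoly.roots.card = Fintype.card n := by
    rw [← (IsAlgClosed.splits N.charpoly).natDegree_eq_card_roots, N.charpoly_natDegree_eq_dim]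
  rcases eq_or_ne y 0 with rfl | hy
  · simp [hcard]
  have e : x • (1 : Matrix n n K) + y • N = (-y) • (Matrix.scalar n (-x / y) - N) := by
    ext i j
    by_cases h : i = j
    · subst h; simp; field_simp; ring
    · simp [h]
  rw [e, Matrix.det_smul, ← Matrix.eval_charpoly]
  conv_lhs => rw [(IsAlgClosed.splits N.charpoly).eq_prod_roots_of_monic N.charpoly_monic]
  rw [Polynomial.eval_multiset_prod, Multiset.map_map, ← hcard, ← Multiset.prod_replicate,
    ← Multiset.map_const', ← Multiset.prod_map_mul]
  congr 1
  refine Multiset.map_congr rfl fun r _ => ?_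
  simp only [Function.comp_apply, Polynomial.eval_sub, Polynomial.eval_X, Polynomial.eval_C]
  field_simp
  ring

theorem isBigO_id_of_mem_secondOrderSolutions {a b w : ℝ → ℂ} (ha : Continuous a)
    (hb : Continuous b) (hw : w ∈ secondOrderSolutions a b) (h : w ≠ 0) :
    (fun t : ℝ => t) =O[𝓝 0] w := by
  by_cases h₀ : w 0 = 0
  · have h₁ : deriv w 0 ≠ 0 := fun h₁ =>
      h (eq_zero_of_mem_secondOrderSolutions ha hb hw h₀ h₁)
    simpa [Function.comp_def, h₀] using
      ((hasDerivAt_of_mem_secondOrderSolutions hw 0).isTheta_sub h₁).isBigO_symm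
  · have hc : Tendsto w (𝓝 0) (𝓝 (w 0)) := hw.1.continuous.tendsto 0
    exact (tendsto_id.isBigO_one ℂ).trans ((isBigO_const_left_iff_pos_le_norm one_ne_zero).2
      ⟨‖w 0‖ / 2, by positivity, (hc.norm.eventually_const_le (by simpa using h₀))⟩)

theorem Asymptotics.IsBigO.pow_card_multiset_prod {ι α : Type*} {l : Filter α} {g : α → ℝ}
    {w : ι → α → ℂ} (s : Multiset ι) (h : ∀ i ∈ s, g =O[l] w i) :
    (fun t => g t ^ s.card) =O[l] fun t => (s.map fun i => w i t).prod := by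
  induction s using Multiset.induction_on with
  | empty => simpa using isBigO_const_const (1 : ℝ) (one_ne_zero (α := ℂ)) l
  | cons i s ih =>
    simp only [Multiset.card_cons, Multiset.map_cons, Multiset.prod_cons, pow_succ']
    exact (h i (Multiset.mem_cons_self i s)).mul
      (ih fun j hj => h j (Multiset.mem_cons_of_mem hj))

theorem isLittleO_pow_of_iterate_deriv_eq_zero {f : ℝ → ℂ} {n : ℕ} (hf : ContDiff ℝ n f)
    (h : ∀ k ≤ n, deriv^[k] f 0 = 0) : f =o[𝓝 0] fun t : ℝ => t ^ n := by
  have h1 := taylor_isLittleO_univ (x₀ := 0) hf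
  have h2 : ∀ t, taylorWithinEval f n univ 0 t = 0 := by
    intro t
    rw [taylor_within_apply]
    refine Finset.sum_eq_zero fun k hk => ?_
    rw [iteratedDerivWithin_univ, iteratedDeriv_eq_iterate, h k (by grind), smul_zero]
  simpa [h2] using h1

/-- SUCP for determinants of matrix solutions of `F'' + aF' + bF = 0` in one
dimension: if `det F` vanishes to order `m+1` at `0` then `det F ≡ 0`. -/
theorem stmt_10 (m : ℕ) (a b : ℝ → ℂ)
    (ha : ContDiff ℝ (⊤ : ℕ∞) a) (hb : ContDiff ℝ (⊤ : ℕ∞) b)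
    (F : ℝ → Matrix (Fin m) (Fin m) ℂ)
    (hF : ∀ i j, ContDiff ℝ (⊤ : ℕ∞) (fun t => F t i j))
    (heq : ∀ i j, ∀ t : ℝ,
      deriv (deriv (fun u => F u i j)) t + a t * deriv (fun u => F u i j) t
        + b t * F t i j = 0)
    (hvan : ∀ k ≤ m, deriv^[k] (fun t => (F t).det) 0 = 0) :
    ∀ t : ℝ, (F t).det = 0 := by
  by_contra! ⟨t₀, ht₀⟩
  have hmem : ∀ i j, (fun t => F t i j) ∈ secondOrderSolutions a b := fun i j =>
    ⟨contDiff_infty.1 (hF i j) 2, heq i j⟩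
  obtain ⟨u, hu, v, hv, huv⟩ :=
    exists_eq_cauchyData_combination ha.continuous hb.continuous t₀
  let B : Matrix (Fin m) (Fin m) ℂ := Matrix.of fun i j => deriv (fun s => F s i j) t₀
  let N := (F t₀)⁻¹ * B
  have hB : F t₀ * N = B := Matrix.mul_nonsing_inv_cancel_left _ _ (isUnit_iff_ne_zero.2 ht₀)
  have hdet : ∀ t, (F t).det =
      (F t₀).det * (N.charpoly.roots.map fun r => u t + v t * r).prod := by
    intro t
    have e : F t = F t₀ * (u t • 1 + v t • N) := by
      rw [mul_add, mul_smul_comm, mul_smul_comm, hB, mul_one]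
      ext i j
      exact huv _ (hmem i j) t
    conv_lhs => rw [e, Matrix.det_mul, Matrix.det_smul_one_add_smul]
  have hw : ∀ r : ℂ, (fun t => u t + v t * r) ∈ secondOrderSolutions a b := fun r => by
    have e : (fun t => u t + v t * r) = u + r • v := by
      ext t
      simp [mul_comm]
    rw [e]
    exact add_mem hu (Submodule.smul_mem _ r hv)
  have hcard : N.charpoly.roots.card = m := by
    rw [← (IsAlgClosed.splits N.charpoly).natDegree_eq_card_roots, N.charpoly_natDegree_eq_dim,
      Fintype.card_fin]
  have hO : (fun t : ℝ => t ^ m) =O[𝓝 0] fun t => (F t).det := by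
    rw [funext hdet]
    refine IsBigO.const_mul_right ht₀ ?_
    have hprod := IsBigO.pow_card_multiset_prod (w := fun r t => u t + v t * r)
      N.charpoly.roots fun r hr => isBigO_id_of_mem_secondOrderSolutions ha.continuous
        hb.continuous (hw r) fun h0 => ht₀ ?_
    · simpa only [hcard] using hprod
    rw [hdet t₀,
      Multiset.prod_eq_zero (Multiset.mem_map.2 ⟨r, hr, congrFun h0 t₀⟩), mul_zero]
  have hdF : ContDiff ℝ m fun t => (F t).det := by
    simp only [Matrix.det_apply]
    exact ContDiff.sum fun σ _ => (contDiff_prod fun i _ =>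
      contDiff_infty.1 (hF (σ i) i) m).const_smul (Equiv.Perm.sign σ)
  have ho := hO.trans_isLittleO (isLittleO_pow_of_iterate_deriv_eq_zero hdF hvan)
  refine isLittleO_irrefl ?_ ho
  have hne : ∀ᶠ t : ℝ in 𝓝[≠] 0, t ^ m ≠ 0 :=
    eventually_mem_nhdsWithin.mono fun t ht => pow_ne_zero m ht
  exact hne.frequently.filter_mono nhdsWithin_le_nhds
end

section
/- Let u be a smooth function on an open neighborhood of 0 in ℝⁿ satisfying aⁱʲ∂_i∂_j u + bⁱ∂_i u + cu = 0, where the coefficients aⁱʲ, bⁱ, c are smooth, (aⁱʲ) is symmetric positive definite, and aⁱʲ(0) = δⁱʲ. Let N ∈ ℕ and suppose all partial derivatives of u of order < N vanish at 0. Then the degree-N homogeneous Taylor polynomial p_N(x) = Σ_{|α|=N} (∂^α u(0)/α!) x^α of u at 0 is harmonic: Σᵢ ∂ᵢ² p_N = 0. -/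
section TaylorPolynomial

open Filter Topology

variable {E : Type*} [NormedAddCommGroup E] [NormedSpace ℝ E]

/-- The degree-`N` homogeneous part of the Taylor expansion of `f` at `0`. -/
noncomputable def homogeneousTaylor (N : ℕ) (f : E → ℝ) (y : E) : ℝ :=
  (N.factorial : ℝ)⁻¹ * iteratedFDeriv ℝ N f 0 (fun _ => y)

theorem homogeneousTaylor_zero (f : E → ℝ) : homogeneousTaylor 0 f = fun _ => f 0 := by
  ext y
  simp [homogeneousTaylor]

theorem ContDiffAt.fderiv_apply_const {f : E → ℝ} {x : E}
    (hf : ContDiffAt ℝ (⊤ : ℕ∞) f x) (v : E) :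
    ContDiffAt ℝ (⊤ : ℕ∞) (fun p => fderiv ℝ f p v) x :=
  (hf.fderiv_right (m := (⊤ : ℕ∞)) (by simp)).clm_apply contDiffAt_const

theorem iteratedFDeriv_fderiv_apply_const {f : E → ℝ} {x : E}
    (hf : ContDiffAt ℝ (⊤ : ℕ∞) f x) (v : E) (k : ℕ) (m : Fin k → E) :
    iteratedFDeriv ℝ k (fun p => fderiv ℝ f p v) x m
      = iteratedFDeriv ℝ (k + 1) f x (Fin.snoc m v : Fin (k + 1) → E) := by
  have h := (ContinuousLinearMap.apply ℝ ℝ v).iteratedFDeriv_comp_left (i := k)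
    (hf.fderiv_right (m := (⊤ : ℕ∞)) (by simp)) (by exact_mod_cast le_top)
  rw [iteratedFDeriv_succ_apply_right, Fin.init_snoc, Fin.snoc_last]
  exact congrArg (fun L => L m) h

theorem iteratedFDeriv_fderiv_apply_const_eq_zero {f : E → ℝ} {x : E}
    (hf : ContDiffAt ℝ (⊤ : ℕ∞) f x) (v : E) {k : ℕ}
    (h : iteratedFDeriv ℝ (k + 1) f x = 0) :
    iteratedFDeriv ℝ k (fun p => fderiv ℝ f p v) x = 0 := by
  ext m
  rw [iteratedFDeriv_fderiv_apply_const hf, h]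
  rfl

theorem fderiv_fderiv_apply_comm_eventuallyEq {f : E → ℝ} {x : E}
    (hf : ContDiffAt ℝ (⊤ : ℕ∞) f x) (v w : E) :
    (fun p => fderiv ℝ (fun q => fderiv ℝ f q v) p w)
      =ᶠ[𝓝 x] fun p => fderiv ℝ (fun q => fderiv ℝ f q w) p v := by
  have h2 : ContDiffAt ℝ 2 f x := contDiffAt_infty.1 hf 2
  filter_upwards [h2.eventually (by simp)] with p hp
  have hd : DifferentiableAt ℝ (fderiv ℝ f) p :=
    (hp.fderiv_right (m := 1) (by norm_num)).differentiableAt (by simp)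
  have hs : IsSymmSndFDerivAt ℝ f p := hp.isSymmSndFDerivAt (by simp)
  have key : ∀ z : E, fderiv ℝ (fun q => fderiv ℝ f q z) p
      = (fderiv ℝ (fderiv ℝ f) p).flip z := fun z => by
    ext y
    simp [fderiv_clm_apply hd (differentiableAt_const z)]
  rw [key, key]
  exact hs w v

theorem sum_iteratedFDeriv_update_const (x y e : E) (N : ℕ) :
    ∀ {f : E → ℝ}, ContDiffAt ℝ (⊤ : ℕ∞) f x →
      ∑ k : Fin (N + 1), iteratedFDeriv ℝ (N + 1) f x (Function.update (fun _ => y) k e)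
        = (N + 1) * iteratedFDeriv ℝ N (fun p => fderiv ℝ f p e) x (fun _ => y) := by
  have snoc_const : ∀ (k : ℕ) (z : E),
      (Fin.snoc (fun _ : Fin k => y) z : Fin (k + 1) → E)
        = Function.update (fun _ => y) (Fin.last k) z := fun k z => by
    ext j
    refine Fin.lastCases ?_ (fun i => ?_) j <;> simp
  have snoc_update : ∀ (k : ℕ) (i : Fin k),
      (Fin.snoc (Function.update (fun _ : Fin k => y) i e) y : Fin (k + 1) → E)
        = Function.update (fun _ => y) i.castSucc e := fun k i => by
    rw [Fin.snoc_update (α := fun _ => E) y (fun _ => y) i e, snoc_const,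
      Function.update_eq_self]
  induction N with
  | zero =>
    intro f hf
    simp
  | succ N ih =>
    intro f hf
    rw [Fin.sum_univ_castSucc, ← snoc_const, ← iteratedFDeriv_fderiv_apply_const hf]
    simp_rw [← snoc_update, ← iteratedFDeriv_fderiv_apply_const hf]
    rw [ih (hf.fderiv_apply_const y),
      (fderiv_fderiv_apply_comm_eventuallyEq hf y e).iteratedFDeriv ℝ N |>.eq_of_nhds,
      iteratedFDeriv_fderiv_apply_const (hf.fderiv_apply_const e), snoc_const,
      Function.update_eq_self]
    push_cast
    ring

theorem fderiv_homogeneousTaylor_succ {f : E → ℝ} (hf : ContDiffAt ℝ (⊤ : ℕ∞) f 0)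
    (N : ℕ) (y e : E) :
    fderiv ℝ (homogeneousTaylor (N + 1) f) y e
      = homogeneousTaylor N (fun p => fderiv ℝ f p e) y := by
  have h := (((iteratedFDeriv ℝ (N + 1) f 0).hasFDerivAt (x := fun _ => y)).comp y
    (ContinuousLinearMap.pi fun _ : Fin (N + 1) =>
      ContinuousLinearMap.id ℝ E).hasFDerivAt).const_mul (((N + 1).factorial : ℝ)⁻¹)
  have h' : fderiv ℝ (homogeneousTaylor (N + 1) f) y = _ := h.fderiv
  rw [h']
  have := sum_iteratedFDeriv_update_const 0 y e N hf
  have hN : ((N : ℝ) + 1) ≠ 0 := by positivity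
  have hN' : (N.factorial : ℝ) ≠ 0 := by positivity
  simp only [homogeneousTaylor, smul_apply, ContinuousLinearMap.comp_apply,
    ContinuousMultilinearMap.linearDeriv_apply, ContinuousLinearMap.coe_pi',
    ContinuousLinearMap.id_apply, smul_eq_mul]
  rw [this, Nat.factorial_succ]
  push_cast
  field_simp

theorem tendsto_div_pow_homogeneousTaylor (x : E) (N : ℕ) :
    ∀ {f : E → ℝ}, ContDiffAt ℝ (⊤ : ℕ∞) f 0 → (∀ k < N, iteratedFDeriv ℝ k f 0 = 0) →
      Tendsto (fun t : ℝ => f (t • x) / t ^ N) (𝓝[>] 0) (𝓝 (homogeneousTaylor N f x)) := by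
  have hline : Tendsto (fun t : ℝ => t • x) (𝓝[>] 0) (𝓝 0) :=
    (Continuous.tendsto' (by fun_prop) 0 0 (by simp)).mono_left nhdsWithin_le_nhds
  induction N with
  | zero =>
    intro f hf _
    simpa [homogeneousTaylor, Function.comp_def] using hf.continuousAt.tendsto.comp hline
  | succ N ih =>
    intro f hf hvan
    have hlim := ih (hf.fderiv_apply_const x) fun k hk =>
      iteratedFDeriv_fderiv_apply_const_eq_zero hf x (hvan (k + 1) (by omega))
    have hf0 : f 0 = 0 := by
      simpa using congrArg (fun L => L 0) (hvan 0 (by omega))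
    have hN : ((N : ℝ) + 1) ≠ 0 := by positivity
    refine HasDerivAt.lhopital_zero_nhdsGT (f' := fun t => fderiv ℝ f (t • x) x)
      (g' := fun t => ((N + 1 : ℕ) : ℝ) * t ^ N) ?_ ?_ ?_ ?_ ?_ ?_
    · have hd : ∀ᶠ p in 𝓝 (0 : E), DifferentiableAt ℝ f p :=
        ((contDiffAt_infty.1 hf 1).eventually (by simp)).mono
          fun p hp => hp.differentiableAt (by simp)
      filter_upwards [hline.eventually hd] with t ht
      simpa [Function.comp_def] using
        ht.hasFDerivAt.comp_hasDerivAt t ((hasDerivAt_id t).smul_const x)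
    · exact Eventually.of_forall fun t => by simpa using hasDerivAt_pow (N + 1) t
    · filter_upwards [self_mem_nhdsWithin] with t ht
      have : t ≠ 0 := ne_of_gt ht
      positivity
    · simpa [hf0, Function.comp_def] using hf.continuousAt.tendsto.comp hline
    · exact (Continuous.tendsto' (by fun_prop) 0 0 (by simp)).mono_left nhdsWithin_le_nhds
    · have hval : homogeneousTaylor (N + 1) f x
          = ((N : ℝ) + 1)⁻¹ * homogeneousTaylor N (fun p => fderiv ℝ f p x) x := by
        have hx : (Fin.snoc (fun _ : Fin N => x) x : Fin (N + 1) → E) = fun _ => x := by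
          ext j
          refine Fin.lastCases ?_ (fun i => ?_) j <;> simp
        rw [homogeneousTaylor, homogeneousTaylor, iteratedFDeriv_fderiv_apply_const hf, hx,
          Nat.factorial_succ]
        push_cast
        rw [mul_inv, mul_assoc]
      rw [hval]
      refine (hlim.const_mul ((N : ℝ) + 1)⁻¹).congr fun t => ?_
      push_cast
      rw [inv_mul_eq_div, div_div, mul_comm]

end TaylorPolynomial

/-- If `u` solves `aⁱʲ∂_i∂_j u + bⁱ∂_i u + cu = 0` with `(aⁱʲ)` symmetric
positive definite and `aⁱʲ(0) = δⁱʲ`, and all partial derivatives of `u` of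
order `< N` vanish at `0`, then the degree-`N` homogeneous Taylor polynomial
`p_N(x) = (1/N!)·D^N u(0)[x,…,x]` of `u` at `0` is harmonic. -/
theorem stmt_13 (n N : ℕ) (U : Set (EuclideanSpace ℝ (Fin n)))
    (hU : IsOpen U) (h0 : (0 : EuclideanSpace ℝ (Fin n)) ∈ U)
    (a : Fin n → Fin n → EuclideanSpace ℝ (Fin n) → ℝ)
    (b : Fin n → EuclideanSpace ℝ (Fin n) → ℝ)
    (c : EuclideanSpace ℝ (Fin n) → ℝ)
    (ha : ∀ i j, ContDiffOn ℝ (⊤ : ℕ∞) (a i j) U)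
    (hb : ∀ i, ContDiffOn ℝ (⊤ : ℕ∞) (b i) U)
    (hc : ContDiffOn ℝ (⊤ : ℕ∞) c U)
    (hsym : ∀ i j, ∀ p ∈ U, a i j p = a j i p)
    (hpos : ∀ p ∈ U, ∀ ξ : Fin n → ℝ, ξ ≠ 0 →
      0 < ∑ i, ∑ j, a i j p * ξ i * ξ j)
    (ha0 : ∀ i j, a i j 0 = if i = j then 1 else 0)
    (u : EuclideanSpace ℝ (Fin n) → ℝ)
    (hu : ContDiffOn ℝ (⊤ : ℕ∞) u U)
    (heq : ∀ p ∈ U,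
      (∑ i, ∑ j, a i j p * pdn i (pdn j u) p) + (∑ i, b i p * pdn i u p)
        + c p * u p = 0)
    (hvan : ∀ k < N, iteratedFDeriv ℝ k u 0 = 0) :
    ∀ x : EuclideanSpace ℝ (Fin n),
      ∑ i, pdn i (pdn i (fun y : EuclideanSpace ℝ (Fin n) =>
        (N.factorial : ℝ)⁻¹ * iteratedFDeriv ℝ N u 0 (fun _ => y))) x = 0 := by
  have hUn : U ∈ nhds (0 : EuclideanSpace ℝ (Fin n)) := hU.mem_nhds h0
  have hu0 : ContDiffAt ℝ (⊤ : ℕ∞) u 0 := hu.contDiffAt hUn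
  have h1 : ∀ i, ContDiffAt ℝ (⊤ : ℕ∞) (pdn i u) 0 := fun i => hu0.fderiv_apply_const _
  have h2 : ∀ i j, ContDiffAt ℝ (⊤ : ℕ∞) (pdn i (pdn j u)) 0 :=
    fun i j => (h1 j).fderiv_apply_const _
  have hstep : ∀ (i : Fin n) (M : ℕ) {f : EuclideanSpace ℝ (Fin n) → ℝ},
      ContDiffAt ℝ (⊤ : ℕ∞) f 0 →
      pdn i (homogeneousTaylor (M + 1) f) = homogeneousTaylor M (pdn i f) :=
    fun i M f hf => funext fun y => fderiv_homogeneousTaylor_succ hf M y _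
  have hconst : ∀ (i : Fin n) (f : EuclideanSpace ℝ (Fin n) → ℝ),
      pdn i (homogeneousTaylor 0 f) = fun _ => 0 := fun i f => by
    ext y
    simp [pdn, homogeneousTaylor_zero]
  intro x
  change ∑ i, pdn i (pdn i (homogeneousTaylor N u)) x = 0
  match N with
  | 0 => simp [hconst, pdn]
  | 1 => simp [hstep _ 0 hu0, hconst]
  | M + 2 =>
    have v1 : ∀ i, ∀ k < M + 1, iteratedFDeriv ℝ k (pdn i u) 0 = 0 := fun i k hk =>
      iteratedFDeriv_fderiv_apply_const_eq_zero hu0 _ (hvan (k + 1) (by omega))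
    have v2 : ∀ i j, ∀ k < M, iteratedFDeriv ℝ k (pdn i (pdn j u)) 0 = 0 := fun i j k hk =>
      iteratedFDeriv_fderiv_apply_const_eq_zero (h1 j) _ (v1 j (k + 1) (by omega))
    simp_rw [hstep _ _ hu0, hstep _ _ (h1 _)]
    have hline : Filter.Tendsto (fun t : ℝ => t • x) (nhdsWithin 0 (Set.Ioi 0)) (nhds 0) :=
      (Continuous.tendsto' (by fun_prop) 0 0 (by simp)).mono_left nhdsWithin_le_nhds
    have hcoef : ∀ {g : EuclideanSpace ℝ (Fin n) → ℝ}, ContDiffOn ℝ (⊤ : ℕ∞) g U →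
        Filter.Tendsto (fun t : ℝ => g (t • x)) (nhdsWithin 0 (Set.Ioi 0)) (nhds (g 0)) :=
      fun hg => (hg.contDiffAt hUn).continuousAt.tendsto.comp hline
    have hlim := ((tendsto_finsetSum Finset.univ fun i _ =>
        tendsto_finsetSum Finset.univ fun j _ =>
          (hcoef (ha i j)).mul (tendsto_div_pow_homogeneousTaylor x M (h2 i j) (v2 i j))).add
      (tendsto_finsetSum Finset.univ fun i _ =>
        (hcoef (hb i)).mul (tendsto_div_pow_homogeneousTaylor x M (h1 i)
          fun k hk => v1 i k (by omega)))).add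
      ((hcoef hc).mul (tendsto_div_pow_homogeneousTaylor x M hu0 fun k hk => hvan k (by omega)))
    have hzero := hlim.congr' (f₂ := fun _ => (0 : ℝ)) (by
      filter_upwards [hline.eventually hUn] with t ht
      have := congrArg (· / t ^ M) (heq (t • x) ht)
      simpa only [add_div, Finset.sum_div, mul_div_assoc, zero_div] using this)
    have hfin := tendsto_nhds_unique hzero tendsto_const_nhds
    have z1 : ∀ i, homogeneousTaylor M (pdn i u) x = 0 := fun i => by
      simp [homogeneousTaylor, v1 i M (by omega)]
    have z0 : homogeneousTaylor M u x = 0 := by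
      simp [homogeneousTaylor, hvan M (by omega)]
    simpa [z1, z0, ha0] using hfin
end

section
/- Let p₁₁, p₁₂, p₂₁, p₂₂ be nonzero real harmonic homogeneous polynomials on ℝ² satisfying p₁₁p₂₂ = p₁₂p₂₁. Then, after possibly applying to the 2×2 array (p_{ij}) a permutation that preserves the relation (swapping the pair (p₁₁,p₂₂) with the pair (p₁₂,p₂₁), and/or swapping the two members within each pair) and rescaling each polynomial by a nonzero real constant, exactly one of the following holds: (i) p₁₁ = p₁₂ and p₂₂ = p₂₁; or (ii) p₂₂ = 1, and there exist k ∈ ℕ with k ≥ 1 and A, B, C, D ∈ ℝ with AC + BD = 0 such that p₁₂ = A·Re(zᵏ) + B·Im(zᵏ), p₂₁ = C·Re(zᵏ) + D·Im(zᵏ) (identifying (x,y) ∈ ℝ² with z = x + iy), and p₁₁ = p₁₂p₂₁. Conversely, in either case the four polynomials are harmonic homogeneous and satisfy p₁₁p₂₂ = p₁₂p₂₁. -/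
/-- A harmonic homogeneous polynomial of degree `k` on `ℝ²`, encoded as a smooth
function, homogeneous of degree `k`, with `∂_x²p + ∂_y²p = 0`. -/
def IsHarmHomog (k : ℕ) (p : ℝ × ℝ → ℝ) : Prop :=
  ContDiff ℝ (⊤ : ℕ∞) p ∧ (∀ (t : ℝ) (v : ℝ × ℝ), p (t • v) = t ^ k * p v) ∧
  (∀ v, pdx (pdx p) v + pdy (pdy p) v = 0)

/-- `Re(zᵏ)` as a function on `ℝ²`, with `z = x + iy`. -/
noncomputable def ReZ (k : ℕ) (v : ℝ × ℝ) : ℝ :=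
  (((v.1 : ℂ) + (v.2 : ℂ) * Complex.I) ^ k).re

/-- `Im(zᵏ)` as a function on `ℝ²`, with `z = x + iy`. -/
noncomputable def ImZ (k : ℕ) (v : ℝ × ℝ) : ℝ :=
  (((v.1 : ℂ) + (v.2 : ℂ) * Complex.I) ^ k).im

/-- The allowed relabelings of the array `(p₁₁, p₁₂, p₂₁, p₂₂)`: swapping the
pair `(p₁₁,p₂₂)` with the pair `(p₁₂,p₂₁)`, and/or swapping the two members
within each pair. -/
def Rearr (p11 p12 p21 p22 q11 q12 q21 q22 : ℝ × ℝ → ℝ) : Prop :=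
  (q11 = p11 ∧ q22 = p22 ∧ q12 = p12 ∧ q21 = p21) ∨
  (q11 = p22 ∧ q22 = p11 ∧ q12 = p12 ∧ q21 = p21) ∨
  (q11 = p11 ∧ q22 = p22 ∧ q12 = p21 ∧ q21 = p12) ∨
  (q11 = p22 ∧ q22 = p11 ∧ q12 = p21 ∧ q21 = p12) ∨
  (q11 = p12 ∧ q22 = p21 ∧ q12 = p11 ∧ q21 = p22) ∨
  (q11 = p21 ∧ q22 = p12 ∧ q12 = p11 ∧ q21 = p22) ∨
  (q11 = p12 ∧ q22 = p21 ∧ q12 = p22 ∧ q21 = p11) ∨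
  (q11 = p21 ∧ q22 = p12 ∧ q12 = p22 ∧ q21 = p11)


open Complex ComplexConjugate

/-- The complex coordinate `z = x + iy` on `ℝ × ℝ`. -/
noncomputable def zCoord (v : ℝ × ℝ) : ℂ := (v.1 : ℂ) + (v.2 : ℂ) * I

/-- The function `Re (w zⁿ)` on `ℝ × ℝ`. -/
noncomputable def reMonomial (w : ℂ) (n : ℕ) (v : ℝ × ℝ) : ℝ := (w * zCoord v ^ n).re

lemma zCoord_smul (t : ℝ) (v : ℝ × ℝ) : zCoord (t • v) = t * zCoord v := by
  simp [zCoord]; ring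

lemma zCoord_re_im (z : ℂ) : zCoord (z.re, z.im) = z := Complex.re_add_im z

lemma reMonomial_smul (w : ℂ) (n : ℕ) (t : ℝ) (v : ℝ × ℝ) :
    reMonomial w n (t • v) = t ^ n * reMonomial w n v := by
  rw [reMonomial, zCoord_smul, mul_pow, mul_left_comm, ← ofReal_pow, re_ofReal_mul, reMonomial]

lemma zCoord_eq_equivRealProdCLM_symm : zCoord = equivRealProdCLM.symm := by
  ext v
  exact (equivRealProd_symm_apply v).symm

lemma reMonomial_zero_left (n : ℕ) : reMonomial 0 n = 0 := by
  ext v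
  simp [reMonomial]

lemma reMonomial_zero_right (w : ℂ) {n : ℕ} (hn : 1 ≤ n) : reMonomial w n 0 = 0 := by
  simp [reMonomial, zCoord, Nat.one_le_iff_ne_zero.1 hn]

lemma hasFDerivAt_zCoord (v : ℝ × ℝ) :
    HasFDerivAt zCoord (equivRealProdCLM.symm : ℝ × ℝ →L[ℝ] ℂ) v := by
  rw [zCoord_eq_equivRealProdCLM_symm]
  exact equivRealProdCLM.symm.hasFDerivAt

lemma hasFDerivAt_reMonomial (w : ℂ) (n : ℕ) (v : ℝ × ℝ) :
    HasFDerivAt (reMonomial w n)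
      (reCLM ∘L ((w * (n * zCoord v ^ (n - 1))) •
        (equivRealProdCLM.symm : ℝ × ℝ →L[ℝ] ℂ))) v := by
  have h := ((hasFDerivAt_zCoord v).pow n).const_mul w
  refine (reCLM.hasFDerivAt.comp v h).congr_fderiv ?_
  ext <;> simp
  ring

lemma contDiff_reMonomial (w : ℂ) (n : ℕ) : ContDiff ℝ (⊤ : ℕ∞) (reMonomial w n) := by
  have h : ContDiff ℝ (⊤ : ℕ∞) zCoord :=
    zCoord_eq_equivRealProdCLM_symm ▸ equivRealProdCLM.symm.contDiff
  exact reCLM.contDiff.comp (contDiff_const.mul (h.pow n))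

lemma pdx_reMonomial (w : ℂ) (n : ℕ) :
    pdx (reMonomial w n) = reMonomial (w * n) (n - 1) := by
  ext v
  simp only [pdx, (hasFDerivAt_reMonomial w n v).fderiv, reMonomial]
  simp [mul_assoc]

lemma pdy_reMonomial (w : ℂ) (n : ℕ) :
    pdy (reMonomial w n) = reMonomial (w * I * n) (n - 1) := by
  ext v
  simp only [pdy, (hasFDerivAt_reMonomial w n v).fderiv, reMonomial]
  have : w * I * n * zCoord v ^ (n - 1) = w * (n * zCoord v ^ (n - 1)) * I := by ring
  rw [this]
  simp

lemma isHarmHomog_reMonomial (w : ℂ) (n : ℕ) : IsHarmHomog n (reMonomial w n) := by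
  refine ⟨contDiff_reMonomial w n, reMonomial_smul w n, fun v => ?_⟩
  rw [pdx_reMonomial, pdx_reMonomial, pdy_reMonomial, pdy_reMonomial, reMonomial, reMonomial,
    ← add_re]
  have : w * I * n * I * ((n - 1 : ℕ) : ℂ) = -(w * n * ((n - 1 : ℕ) : ℂ)) := by
    linear_combination w * n * ((n - 1 : ℕ) : ℂ) * I_mul_I
  rw [this]
  simp

lemma reMonomial_eq (w : ℂ) (k : ℕ) (v : ℝ × ℝ) :
    reMonomial w k v = w.re * ReZ k v + (-w.im) * ImZ k v := by
  simp [reMonomial, ReZ, ImZ, zCoord, mul_re]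
  ring

lemma mul_ReZ_add_mul_ImZ (A B : ℝ) (k : ℕ) (v : ℝ × ℝ) :
    A * ReZ k v + B * ImZ k v = reMonomial (A - B * I) k v := by
  simp [reMonomial_eq]

/-- Orthogonal harmonics of the same degree have a harmonic product. -/
lemma reMonomial_mul_reMonomial (c d : ℂ) (k : ℕ) (h : c.re * d.re + c.im * d.im = 0)
    (v : ℝ × ℝ) :
    reMonomial c k v * reMonomial d k v = reMonomial (c * d / 2) (2 * k) v := by
  have h2 : c * d / 2 * zCoord v ^ (2 * k) =
      (1 / 2 : ℝ) * ((c * zCoord v ^ k) * (d * zCoord v ^ k)) := by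
    push_cast
    ring
  rw [reMonomial, reMonomial, reMonomial, h2, re_ofReal_mul]
  generalize zCoord v ^ k = z
  simp only [mul_re, mul_im]
  linear_combination (1 / 2) * (z.re ^ 2 + z.im ^ 2) * h

lemma hasFDerivAt_fderiv_apply {p : ℝ × ℝ → ℝ} (hp : ContDiff ℝ (⊤ : ℕ∞) p) (w v : ℝ × ℝ) :
    HasFDerivAt (fun v => fderiv ℝ p v w) ((fderiv ℝ (fderiv ℝ p) v).flip w) v := by
  have h : ContDiff ℝ 1 (fderiv ℝ p) := hp.fderiv_right (by norm_cast)
  have h1 := (h.differentiable one_ne_zero v).hasFDerivAt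
  exact (h1.clm_apply (hasFDerivAt_const w v)).congr_fderiv (by ext <;> simp)

/-- The Wirtinger derivative `p_x - i p_y` of a harmonic function is holomorphic. -/
lemma differentiable_wirtinger {p : ℝ × ℝ → ℝ} (hp : ContDiff ℝ (⊤ : ℕ∞) p)
    (hΔ : ∀ v, pdx (pdx p) v + pdy (pdy p) v = 0) :
    Differentiable ℂ fun z : ℂ =>
      ((pdx p (z.re, z.im) : ℝ) : ℂ) - I * ((pdy p (z.re, z.im) : ℝ) : ℂ) := by
  intro z
  have hL : HasFDerivAt (fun z : ℂ => (z.re, z.im)) (equivRealProdCLM : ℂ →L[ℝ] ℝ × ℝ) z :=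
    equivRealProdCLM.hasFDerivAt
  have hx := ofRealCLM.hasFDerivAt.comp z
    (((hasFDerivAt_fderiv_apply hp (1, 0) (z.re, z.im)).comp z hL))
  have hy := ofRealCLM.hasFDerivAt.comp z
    (((hasFDerivAt_fderiv_apply hp (0, 1) (z.re, z.im)).comp z hL))
  have hf := hx.sub (hy.const_mul I)
  have hsymm : IsSymmSndFDerivAt ℝ p (z.re, z.im) :=
    hp.contDiffAt.isSymmSndFDerivAt (by simp; norm_cast)
  have hxy := hsymm.eq (1, 0) (0, 1)
  have hlap := hΔ (z.re, z.im)
  have e1 : pdx (pdx p) (z.re, z.im) =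
      fderiv ℝ (fderiv ℝ p) (z.re, z.im) (1, 0) (1, 0) := by
    rw [pdx, show pdx p = fun v => fderiv ℝ p v (1, 0) from rfl,
      (hasFDerivAt_fderiv_apply hp (1, 0) _).fderiv]
    rfl
  have e2 : pdy (pdy p) (z.re, z.im) =
      fderiv ℝ (fderiv ℝ p) (z.re, z.im) (0, 1) (0, 1) := by
    rw [pdy, show pdy p = fun v => fderiv ℝ p v (0, 1) from rfl,
      (hasFDerivAt_fderiv_apply hp (0, 1) _).fderiv]
    rfl
  rw [e1, e2] at hlap
  refine differentiableAt_complex_iff_differentiableAt_real.2 ⟨hf.differentiableAt, ?_⟩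
  refine (congrArg (· I) hf.fderiv).trans (.trans ?_ (congrArg (I • · 1) hf.fderiv).symm)
  apply Complex.ext
  · simp [hxy]
  · simp
    linarith

/-- A holomorphic function off the origin invariant under positive scaling is constant. -/
lemma exists_const_of_scale_invariant {G : ℂ → ℂ}
    (hG : ∀ z, z ≠ 0 → DifferentiableAt ℂ G z)
    (hs : ∀ t : ℝ, 0 < t → ∀ z, z ≠ 0 → G (t * z) = G z) :
    ∃ c, ∀ z, z ≠ 0 → G z = c := by
  have hpre : IsPreconnected ({0}ᶜ : Set ℂ) :=
    (isConnected_compl_singleton_of_one_lt_rank (by simp) 0).isPreconnected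
  refine isOpen_compl_singleton.exists_is_const_of_deriv_eq_zero hpre
    (fun z hz => (hG z hz).differentiableWithinAt) fun z hz => ?_
  have h1 : HasDerivAt (fun t : ℂ => t * z) z ((1 : ℝ) : ℂ) := by
    simpa using (hasDerivAt_id (((1 : ℝ) : ℂ))).mul_const z
  have h2 : HasDerivAt G (deriv G z) (((1 : ℝ) : ℂ) * z) := by
    simpa using (hG z hz).hasDerivAt
  have h3 : HasDerivAt (fun t : ℝ => G (t * z)) (deriv G z * z) 1 :=
    (HasDerivAt.comp (h₂ := G) ((1 : ℝ) : ℂ) h2 h1).comp_ofReal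
  have h4 : HasDerivAt (fun t : ℝ => G (t * z)) 0 1 := by
    refine (hasDerivAt_const (1 : ℝ) (G z)).congr_of_eventuallyEq ?_
    filter_upwards [lt_mem_nhds (zero_lt_one' ℝ)] with t ht using hs t ht z hz
  simpa [show z ≠ 0 from hz] using h3.unique h4

lemma fderiv_smul_of_homog {p : ℝ × ℝ → ℝ} (hp : ContDiff ℝ (⊤ : ℕ∞) p) {k : ℕ}
    (hk : ∀ (t : ℝ) (v : ℝ × ℝ), p (t • v) = t ^ k * p v) (t : ℝ) (v w : ℝ × ℝ) :
    t * fderiv ℝ p (t • v) w = t ^ k * fderiv ℝ p v w := by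
  have hd : Differentiable ℝ p := hp.differentiable (by simp)
  have h1 := (hd (t • v)).hasFDerivAt.comp v ((hasFDerivAt_id v).const_smul t)
  have h2 := (hd v).hasFDerivAt.const_mul (t ^ k)
  have h3 : p ∘ (t • ·) = fun v => t ^ k * p v := funext (hk t)
  have h1 : HasFDerivAt (p ∘ (t • ·)) _ v := h1
  rw [h3] at h1
  simpa using congrArg (· w) (h1.unique h2)

lemma euler_of_homog {p : ℝ × ℝ → ℝ} (hp : ContDiff ℝ (⊤ : ℕ∞) p) {k : ℕ}
    (hk : ∀ (t : ℝ) (v : ℝ × ℝ), p (t • v) = t ^ k * p v) (v : ℝ × ℝ) :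
    v.1 * pdx p v + v.2 * pdy p v = k * p v := by
  have hd : Differentiable ℝ p := hp.differentiable (by simp)
  have h0 : HasDerivAt (fun t : ℝ => t • v) v 1 := by
    simpa using (hasDerivAt_id (1 : ℝ)).smul_const v
  have h1 : HasDerivAt (fun t : ℝ => p (t • v)) (fderiv ℝ p v v) 1 :=
    HasFDerivAt.comp_hasDerivAt (1 : ℝ) (by simpa using (hd v).hasFDerivAt) h0
  have h2 : HasDerivAt (fun t : ℝ => p (t • v)) (k * p v) 1 := by
    simp_rw [hk]
    simpa using (hasDerivAt_pow k (1 : ℝ)).mul_const (p v)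
  have h3 : v = v.1 • ((1, 0) : ℝ × ℝ) + v.2 • ((0, 1) : ℝ × ℝ) := by
    ext <;> simp
  have h4 := congrArg (fderiv ℝ p v) h3
  rw [map_add, map_smul, map_smul] at h4
  rw [← h1.unique h2, h4]
  rfl

/-- Every harmonic homogeneous function of degree `k` is of the form `Re (w zᵏ)`. -/
lemma IsHarmHomog.exists_eq_reMonomial {k : ℕ} {p : ℝ × ℝ → ℝ} (h : IsHarmHomog k p) :
    ∃ w : ℂ, (k = 0 → w.im = 0) ∧ p = reMonomial w k := by
  obtain ⟨hp, hk, hΔ⟩ := h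
  rcases Nat.eq_zero_or_pos k with rfl | hpos
  · refine ⟨p 0, by simp, funext fun v => ?_⟩
    have := hk 0 v
    simp only [zero_smul, pow_zero, one_mul] at this
    simp [reMonomial, this]
  set f : ℂ → ℂ := fun z => ((pdx p (z.re, z.im) : ℝ) : ℂ) - I * ((pdy p (z.re, z.im) : ℝ) : ℂ)
    with hf
  have hfd : Differentiable ℂ f := differentiable_wirtinger hp hΔ
  have hfs (t : ℝ) (z : ℂ) : t * f (t * z) = t ^ k * f z := by
    have e : (((t * z : ℂ)).re, ((t * z : ℂ)).im) = t • (z.re, z.im) := by simp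
    have hx := congrArg ((↑) : ℝ → ℂ) (fderiv_smul_of_homog hp hk t (z.re, z.im) (1, 0))
    have hy := congrArg ((↑) : ℝ → ℂ) (fderiv_smul_of_homog hp hk t (z.re, z.im) (0, 1))
    simp only [hf, e, pdx, pdy]
    push_cast at hx hy
    linear_combination hx - I * hy
  obtain ⟨c, hc⟩ := exists_const_of_scale_invariant (G := fun z => z * f z / z ^ k)
    (fun z hz => (differentiableAt_id.mul (hfd z)).div (differentiableAt_id.pow k)
      (pow_ne_zero k hz)) (fun t ht z hz => by
        have ht' : (t : ℂ) ≠ 0 := by exact_mod_cast ht.ne'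
        rw [div_eq_div_iff (pow_ne_zero _ (mul_ne_zero ht' hz)) (pow_ne_zero _ hz), mul_pow]
        linear_combination z * z ^ k * hfs t z)
  refine ⟨c / k, fun h0 => absurd h0 hpos.ne', funext fun v => ?_⟩
  have hk0 : (k : ℝ) ≠ 0 := by exact_mod_cast hpos.ne'
  have hzf : zCoord v * f (zCoord v) = c * zCoord v ^ k := by
    by_cases hz : zCoord v = 0
    · simp [hz, hpos.ne']
    · rw [← hc _ hz, div_mul_cancel₀ _ (pow_ne_zero _ hz)]
  have hre : (zCoord v * f (zCoord v)).re = k * p v := by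
    rw [← euler_of_homog hp hk v]
    simp [hf, zCoord]
  have e : c / k * zCoord v ^ k = ((k : ℝ)⁻¹ : ℝ) * (c * zCoord v ^ k) := by
    push_cast
    ring
  rw [reMonomial, e, re_ofReal_mul, ← hzf, hre, inv_mul_cancel_left₀ hk0]

open Polynomial in
/-- The polynomial `w Xⁿ + w̄`, whose value at `u²` is `2 uⁿ Re (w uⁿ)` for `|u| = 1`. -/
noncomputable def circlePoly (w : ℂ) (n : ℕ) : Polynomial ℂ := C w * X ^ n + C (conj w)

lemma circlePoly_ne_zero {w : ℂ} {n : ℕ} (hw : w ≠ 0) (hn : n = 0 → w.im = 0) :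
    circlePoly w n ≠ 0 := by
  intro h
  have h0 := congrArg (Polynomial.coeff · n) h
  rcases Nat.eq_zero_or_pos n with rfl | hpos
  · have hc : conj w = w := conj_eq_iff_im.2 (hn rfl)
    simp [circlePoly, hc] at h0
    exact hw h0
  · simp [circlePoly, Polynomial.coeff_C, hpos.ne'] at h0
    exact hw h0

lemma eval_circlePoly_sq {v : ℝ × ℝ} (hv : v.1 ^ 2 + v.2 ^ 2 = 1) (w : ℂ) (n : ℕ) :
    (circlePoly w n).eval (zCoord v ^ 2) = 2 * zCoord v ^ n * (reMonomial w n v : ℂ) := by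
  have hconj : zCoord v * conj (zCoord v) = 1 := by
    rw [mul_conj, normSq_apply]
    simp only [zCoord, add_re, ofReal_re, mul_re, I_re, add_im, ofReal_im, mul_im, I_im]
    exact_mod_cast (by linear_combination hv)
  have hre := add_conj (w * zCoord v ^ n)
  have hn : zCoord v ^ n * conj (zCoord v) ^ n = 1 := by rw [← mul_pow, hconj, one_pow]
  simp only [map_mul, map_pow] at hre
  simp only [circlePoly, Polynomial.eval_add, Polynomial.eval_mul, Polynomial.eval_C,
    Polynomial.eval_pow, Polynomial.eval_X, reMonomial]
  push_cast at hre
  linear_combination zCoord v ^ n * hre - conj w * hn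

lemma infinite_zCoord_sq : (zCoord '' {v | v.1 ^ 2 + v.2 ^ 2 = 1} |>.image (· ^ 2)).Infinite := by
  refine Set.Infinite.mono (s := Metric.sphere (0 : ℂ) 1) ?_ ?_
  · intro z hz
    obtain ⟨u, hu⟩ := IsAlgClosed.exists_pow_nat_eq z (n := 2) two_pos
    have hz1 : ‖z‖ = 1 := by simpa using hz
    have hu1 : ‖u‖ ^ 2 = 1 := by rw [← norm_pow, hu, hz1]
    refine ⟨u, ⟨(u.re, u.im), ?_, zCoord_re_im u⟩, hu⟩
    rw [Complex.sq_norm, normSq_apply] at hu1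
    simpa [sq] using hu1
  · exact (isPreconnected_sphere (by simp) 0 1).infinite_of_nontrivial
      ⟨1, by simp, -1, by simp, by norm_num⟩

lemma polynomial_ext_of_circle {P Q : Polynomial ℂ}
    (h : ∀ v : ℝ × ℝ, v.1 ^ 2 + v.2 ^ 2 = 1 → P.eval (zCoord v ^ 2) = Q.eval (zCoord v ^ 2)) :
    P = Q := by
  refine P.eq_of_infinite_eval_eq Q (infinite_zCoord_sq.mono ?_)
  rintro _ ⟨_, ⟨v, hv, rfl⟩, rfl⟩
  exact h v hv

section Products

variable {a b c d : ℂ} {m n r s : ℕ}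

lemma degree_eq_of_mul_eq (ha : a ≠ 0) (hb : b ≠ 0) (ham : m = 0 → a.im = 0)
    (hbn : n = 0 → b.im = 0)
    (h : ∀ v, reMonomial a m v * reMonomial b n v = reMonomial c r v * reMonomial d s v) :
    m + n = r + s := by
  by_contra hne
  have hzero : ∀ v, reMonomial a m v * reMonomial b n v = 0 := fun v => by
    have h2 := h ((2 : ℝ) • v)
    simp only [reMonomial_smul] at h2
    have h3 : ((2 : ℝ) ^ (m + n) - 2 ^ (r + s)) * (reMonomial a m v * reMonomial b n v) = 0 := by
      rw [pow_add, pow_add]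
      linear_combination h2 - 2 ^ r * 2 ^ s * h v
    refine (mul_eq_zero.1 h3).resolve_left (sub_ne_zero.2 fun h4 => hne ?_)
    exact (pow_right_injective₀ two_pos (by norm_num)) h4
  have hP : circlePoly a m * circlePoly b n = 0 := polynomial_ext_of_circle fun v hv => by
    have hv0 : (reMonomial a m v : ℂ) * reMonomial b n v = 0 := by exact_mod_cast hzero v
    rw [Polynomial.eval_mul, eval_circlePoly_sq hv, eval_circlePoly_sq hv, Polynomial.eval_zero]
    linear_combination 4 * zCoord v ^ m * zCoord v ^ n * hv0
  exact mul_ne_zero (circlePoly_ne_zero ha ham) (circlePoly_ne_zero hb hbn) hP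

lemma circlePoly_mul_eq (hdeg : m + n = r + s)
    (h : ∀ v, reMonomial a m v * reMonomial b n v = reMonomial c r v * reMonomial d s v) :
    circlePoly a m * circlePoly b n = circlePoly c r * circlePoly d s :=
  polynomial_ext_of_circle fun v hv => by
    have hv0 : (reMonomial a m v : ℂ) * reMonomial b n v = reMonomial c r v * reMonomial d s v := by
      exact_mod_cast h v
    have hpow : zCoord v ^ m * zCoord v ^ n = zCoord v ^ r * zCoord v ^ s := by
      rw [← pow_add, ← pow_add, hdeg]
    simp only [Polynomial.eval_mul, eval_circlePoly_sq hv]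
    linear_combination 4 * zCoord v ^ m * zCoord v ^ n * hv0 +
      4 * (reMonomial c r v : ℂ) * reMonomial d s v * hpow

lemma coeff_circlePoly_mul (a b : ℂ) (m n k : ℕ) :
    (circlePoly a m * circlePoly b n).coeff k =
      (if k = m + n then a * b else 0) + (if k = m then a * conj b else 0) +
      (if k = n then conj a * b else 0) + (if k = 0 then conj a * conj b else 0) := by
  have e : circlePoly a m * circlePoly b n =
      Polynomial.C (a * b) * Polynomial.X ^ (m + n) +
      Polynomial.C (a * conj b) * Polynomial.X ^ m +
      Polynomial.C (conj a * b) * Polynomial.X ^ n + Polynomial.C (conj a * conj b) := by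
    simp only [circlePoly, map_mul, pow_add]
    ring
  rw [e]
  simp only [Polynomial.coeff_add, Polynomial.coeff_C_mul, Polynomial.coeff_X_pow,
    Polynomial.coeff_C, mul_ite, mul_one, mul_zero]

/-- If `ab = cd` and `a b̄ = c d̄`, the two pairs are real multiples of each other. -/
lemma exists_real_ratio (ha : a ≠ 0) (hb : b ≠ 0) (hc : c ≠ 0) (h1 : a * b = c * d)
    (h2 : a * conj b = c * conj d) : ∃ t : ℝ, t ≠ 0 ∧ c = t * a ∧ b = t * d := by
  have hd : d ≠ 0 := by
    rintro rfl
    simp [ha, hb] at h1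
  have hd' : conj d ≠ 0 := (map_ne_zero _).2 hd
  have e1 : c / a = b / d := by
    rw [div_eq_div_iff ha hd, ← h1, mul_comm]
  have e2 : c / a = conj (b / d) := by
    rw [map_div₀, div_eq_div_iff ha hd', ← h2, mul_comm]
  obtain ⟨t, ht⟩ := conj_eq_iff_real.1 ((congrArg conj e1).trans e2.symm)
  refine ⟨t, ?_, ?_, ?_⟩
  · rintro rfl
    simp [ha, hc] at ht
  · rw [← ht, div_mul_cancel₀ _ ha]
  · rw [← ht, e1, div_mul_cancel₀ _ hd]

lemma reMonomial_ofReal_mul (t : ℝ) (w : ℂ) (n : ℕ) (v : ℝ × ℝ) :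
    reMonomial (t * w) n v = t * reMonomial w n v := by
  rw [reMonomial, mul_assoc, re_ofReal_mul, reMonomial]

/-- `q₁₁` is proportional to `q₁₂`, and `q₂₂` to `q₂₁`. -/
def Proportional (q11 q12 q21 q22 : ℝ × ℝ → ℝ) : Prop :=
  ∃ t u : ℝ, t ≠ 0 ∧ u ≠ 0 ∧ (∀ v, t * q11 v = q12 v) ∧ (∀ v, q22 v = u * q21 v)

/-- `q₂₂` is a nonzero constant `b`, `q₁₂` and `q₂₁` are orthogonal harmonics of the same positive
degree, and `b q₁₁ = q₁₂ q₂₁`. -/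
def OrthogonalFactors (q11 q12 q21 q22 : ℝ × ℝ → ℝ) : Prop :=
  ∃ b : ℝ, b ≠ 0 ∧ (∀ v, q22 v = b) ∧ ∃ k : ℕ, 1 ≤ k ∧ ∃ c d : ℂ,
    c.re * d.re + c.im * d.im = 0 ∧ q12 = reMonomial c k ∧ q21 = reMonomial d k ∧
    ∀ v, b * q11 v = q12 v * q21 v

/-- The classification when the degrees satisfy `n ≤ s ≤ r ≤ m`. -/
lemma classification_of_sorted (ha : a ≠ 0) (hb : b ≠ 0) (hc : c ≠ 0) (hd : d ≠ 0)
    (ham : m = 0 → a.im = 0) (hbn : n = 0 → b.im = 0) (hds : s = 0 → d.im = 0)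
    (h : ∀ v, reMonomial a m v * reMonomial b n v = reMonomial c r v * reMonomial d s v)
    (hrm : r ≤ m) (hsr : s ≤ r) :
    Proportional (reMonomial a m) (reMonomial c r) (reMonomial d s) (reMonomial b n) ∨
    Proportional (reMonomial a m) (reMonomial d s) (reMonomial c r) (reMonomial b n) ∨
    OrthogonalFactors (reMonomial a m) (reMonomial c r) (reMonomial d s) (reMonomial b n) := by
  have hdeg := degree_eq_of_mul_eq ha hb ham hbn h
  have hcoeff (k : ℕ) := congrArg (Polynomial.coeff · k) (circlePoly_mul_eq hdeg h)
  simp only [coeff_circlePoly_mul] at hcoeff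
  have hprop : ∀ {a b c d : ℂ} {m n : ℕ}, a ≠ 0 → b ≠ 0 → c ≠ 0 → a * b = c * d →
      a * conj b = c * conj d →
      Proportional (reMonomial a m) (reMonomial c m) (reMonomial d n) (reMonomial b n) := by
    intro a b c d m n ha hb hc h1 h2
    obtain ⟨t, ht, rfl, rfl⟩ := exists_real_ratio ha hb hc h1 h2
    exact ⟨t, t, ht, ht, fun v => (reMonomial_ofReal_mul t a m v).symm,
      fun v => reMonomial_ofReal_mul t d n v⟩
  rcases hrm.eq_or_lt with rfl | hlt
  · obtain rfl : n = s := by omega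
    rcases Nat.eq_zero_or_pos n with rfl | hn
    · left
      obtain ⟨β, rfl⟩ := conj_eq_iff_real.1 (conj_eq_iff_im.2 (hbn rfl))
      obtain ⟨δ, rfl⟩ := conj_eq_iff_real.1 (conj_eq_iff_im.2 (hds rfl))
      have hβ : β ≠ 0 := by exact_mod_cast hb
      have hδ : δ ≠ 0 := by exact_mod_cast hd
      refine ⟨β / δ, β / δ, div_ne_zero hβ hδ, div_ne_zero hβ hδ, fun v => ?_, fun v => ?_⟩
      · have := h v
        simp only [reMonomial, pow_zero, mul_one, ofReal_re] at this ⊢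
        rw [div_mul_eq_mul_div, div_eq_iff hδ]
        linear_combination this
      · simp [reMonomial, hδ]
    have htop : a * b = c * d := by
      have := hcoeff (r + n)
      simpa [show r ≠ 0 by omega, hn.ne'] using this
    rcases hsr.eq_or_lt with rfl | hlt
    · have hmid : a * conj b + conj a * b = c * conj d + conj c * d := by
        have := hcoeff n
        simpa [hn.ne'] using this
      have hroot : (a * conj b - c * conj d) * (a * conj b - d * conj c) = 0 := by
        have hbar : conj a * conj b = conj c * conj d := by
          rw [← map_mul, htop, map_mul]
        linear_combination a * conj b * hmid - a * b * hbar - conj c * conj d * htop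
      rcases mul_eq_zero.1 hroot with h1 | h1
      · exact .inl (hprop ha hb hc htop (sub_eq_zero.1 h1))
      · exact .inr (.inl (hprop ha hb hd (by rw [htop, mul_comm]) (sub_eq_zero.1 h1)))
    · have hmid : a * conj b = c * conj d := by
        have := hcoeff r
        simpa [hn.ne', hlt.ne', show r ≠ 0 by omega] using this
      exact .inl (hprop ha hb hc htop hmid)
  · rcases Nat.eq_zero_or_pos n with rfl | hn
    · obtain ⟨β, rfl⟩ := conj_eq_iff_real.1 (conj_eq_iff_im.2 (hbn rfl))
      have hβ : β ≠ 0 := by exact_mod_cast hb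
      have hr0 : r ≠ 0 := by omega
      have hs0 : s ≠ 0 := by omega
      rcases hsr.eq_or_lt with rfl | hlt'
      · right; right
        have hmid := hcoeff s
        simp [hlt.ne, hr0] at hmid
        refine ⟨β, hβ, by simp [reMonomial], s, by omega, c, d, ?_, rfl, rfl, fun v => ?_⟩
        · have := congrArg re hmid
          simp at this
          linarith
        · rw [← h v]
          simp [reMonomial, mul_comm]
      · have hmid := hcoeff r
        simp [hlt.ne, hr0, hs0, hlt'.ne', hc, hd] at hmid
    · have hmid := hcoeff m
      simp [show m ≠ r + s by omega, show m ≠ 0 by omega, hn.ne', hlt.ne', show m ≠ s by omega,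
        show m ≠ n by omega, ha, hb] at hmid

end Products

/-- The dichotomy asserted by the classification, for an array already rearranged. -/
def Dichotomy (q11 q12 q21 q22 : ℝ × ℝ → ℝ) : Prop :=
  ∃ c11 c12 c21 c22 : ℝ,
    c11 ≠ 0 ∧ c12 ≠ 0 ∧ c21 ≠ 0 ∧ c22 ≠ 0 ∧
    Xor
      ((∀ v, c11 * q11 v = c12 * q12 v) ∧ (∀ v, c22 * q22 v = c21 * q21 v))
      ((∀ v, c22 * q22 v = 1) ∧
        ∃ k : ℕ, 1 ≤ k ∧ ∃ A B C D : ℝ, A * C + B * D = 0 ∧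
          (∀ v, c12 * q12 v = A * ReZ k v + B * ImZ k v) ∧
          (∀ v, c21 * q21 v = C * ReZ k v + D * ImZ k v) ∧
          (∀ v, c11 * q11 v = (c12 * q12 v) * (c21 * q21 v)))

lemma Proportional.dichotomy {q11 q12 q21 q22 : ℝ × ℝ → ℝ} (h : Proportional q11 q12 q21 q22) :
    Dichotomy q11 q12 q21 q22 := by
  obtain ⟨t, u, ht, hu, h1, h2⟩ := h
  refine ⟨t, 1, u, 1, ht, one_ne_zero, hu, one_ne_zero,
    .inl ⟨⟨by simpa using h1, by simpa using h2⟩, ?_⟩⟩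
  rintro ⟨h3, k, hk, A, B, C, D, -, -, h4, -⟩
  have e0 := h4 0
  rw [← h2, ← one_mul (q22 0), h3, mul_ReZ_add_mul_ImZ] at e0
  simp [reMonomial_zero_right _ hk] at e0

lemma OrthogonalFactors.dichotomy {q11 q12 q21 q22 : ℝ × ℝ → ℝ}
    (h : OrthogonalFactors q11 q12 q21 q22) : Dichotomy q11 q12 q21 q22 := by
  obtain ⟨b, hb, h22, k, hk, c, d, hcd, rfl, rfl, h11⟩ := h
  refine ⟨b, 1, 1, b⁻¹, hb, one_ne_zero, one_ne_zero, inv_ne_zero hb,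
    .inr ⟨⟨fun v => by rw [h22, inv_mul_cancel₀ hb], k, hk, c.re, -c.im, d.re, -d.im,
      by linear_combination hcd, fun v => by rw [one_mul, reMonomial_eq],
      fun v => by rw [one_mul, reMonomial_eq], by simpa using h11⟩, ?_⟩⟩
  rintro ⟨-, h1⟩
  have e0 := h1 0
  rw [h22, inv_mul_cancel₀ hb, reMonomial_zero_right _ hk] at e0
  simp at e0

/-- Some admissible rearrangement of the array satisfies the dichotomy. -/
def Classified (p11 p12 p21 p22 : ℝ × ℝ → ℝ) : Prop :=
  ∃ q11 q12 q21 q22 : ℝ × ℝ → ℝ,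
    Rearr p11 p12 p21 p22 q11 q12 q21 q22 ∧ Dichotomy q11 q12 q21 q22

lemma Classified.swap_diagonal {p11 p12 p21 p22 : ℝ × ℝ → ℝ} (h : Classified p22 p12 p21 p11) :
    Classified p11 p12 p21 p22 := by
  obtain ⟨q11, q12, q21, q22, hr, hd⟩ := h
  exact ⟨q11, q12, q21, q22, by
    rcases hr with h | h | h | h | h | h | h | h <;> simp [Rearr, h], hd⟩

lemma Classified.swap_antidiagonal {p11 p12 p21 p22 : ℝ × ℝ → ℝ}
    (h : Classified p11 p21 p12 p22) : Classified p11 p12 p21 p22 := by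
  obtain ⟨q11, q12, q21, q22, hr, hd⟩ := h
  exact ⟨q11, q12, q21, q22, by
    rcases hr with h | h | h | h | h | h | h | h <;> simp [Rearr, h], hd⟩

lemma Classified.swap_pairs {p11 p12 p21 p22 : ℝ × ℝ → ℝ} (h : Classified p12 p11 p22 p21) :
    Classified p11 p12 p21 p22 := by
  obtain ⟨q11, q12, q21, q22, hr, hd⟩ := h
  exact ⟨q11, q12, q21, q22, by
    rcases hr with h | h | h | h | h | h | h | h <;> simp [Rearr, h], hd⟩

lemma classified_of_mul_eq {a b c d : ℂ} {m n r s : ℕ} (ha : a ≠ 0) (hb : b ≠ 0) (hc : c ≠ 0)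
    (hd : d ≠ 0) (ham : m = 0 → a.im = 0) (hbn : n = 0 → b.im = 0) (hcr : r = 0 → c.im = 0)
    (hds : s = 0 → d.im = 0)
    (h : ∀ v, reMonomial a m v * reMonomial b n v = reMonomial c r v * reMonomial d s v) :
    Classified (reMonomial a m) (reMonomial c r) (reMonomial d s) (reMonomial b n) := by
  wlog hnm : n ≤ m generalizing a b m n
  · exact (this hb ha hbn ham (fun v => by rw [mul_comm, h]) (by omega)).swap_diagonal
  wlog hsr : s ≤ r generalizing c d r s
  · exact (this hd hc hds hcr (fun v => by rw [h, mul_comm]) (by omega)).swap_antidiagonal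
  wlog hrm : r ≤ m generalizing a b c d m n r s
  · exact (this hc hd hcr hds hsr ha hb ham hbn (fun v => (h v).symm) hnm (by omega)).swap_pairs
  rcases classification_of_sorted ha hb hc hd ham hbn hds h hrm hsr with h | h | h
  · exact ⟨_, _, _, _, .inl ⟨rfl, rfl, rfl, rfl⟩, h.dichotomy⟩
  · exact .swap_antidiagonal ⟨_, _, _, _, .inl ⟨rfl, rfl, rfl, rfl⟩, h.dichotomy⟩
  · exact ⟨_, _, _, _, .inl ⟨rfl, rfl, rfl, rfl⟩, h.dichotomy⟩

/-- Classification of quadruples of nonzero real harmonic homogeneous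
polynomials on `ℝ²` with `p₁₁p₂₂ = p₁₂p₂₁`, together with the converse. -/
theorem stmt_14 :
    (∀ p11 p12 p21 p22 : ℝ × ℝ → ℝ,
      (∃ k, IsHarmHomog k p11) → (∃ k, IsHarmHomog k p12) →
      (∃ k, IsHarmHomog k p21) → (∃ k, IsHarmHomog k p22) →
      p11 ≠ 0 → p12 ≠ 0 → p21 ≠ 0 → p22 ≠ 0 →
      (∀ v, p11 v * p22 v = p12 v * p21 v) →
      ∃ q11 q12 q21 q22 : ℝ × ℝ → ℝ,
        Rearr p11 p12 p21 p22 q11 q12 q21 q22 ∧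
        ∃ c11 c12 c21 c22 : ℝ,
          c11 ≠ 0 ∧ c12 ≠ 0 ∧ c21 ≠ 0 ∧ c22 ≠ 0 ∧
          Xor'
            ((∀ v, c11 * q11 v = c12 * q12 v) ∧ (∀ v, c22 * q22 v = c21 * q21 v))
            ((∀ v, c22 * q22 v = 1) ∧
              ∃ k : ℕ, 1 ≤ k ∧ ∃ A B C D : ℝ, A * C + B * D = 0 ∧
                (∀ v, c12 * q12 v = A * ReZ k v + B * ImZ k v) ∧
                (∀ v, c21 * q21 v = C * ReZ k v + D * ImZ k v) ∧
                (∀ v, c11 * q11 v = (c12 * q12 v) * (c21 * q21 v)))) ∧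
    -- Converse: each of the two cases does give `p₁₁p₂₂ = p₁₂p₂₁`, with all
    -- entries harmonic homogeneous.
    ((∀ p11 p12 p21 p22 : ℝ × ℝ → ℝ,
        (∀ v, p11 v = p12 v) → (∀ v, p22 v = p21 v) →
        ∀ v, p11 v * p22 v = p12 v * p21 v) ∧
      (∀ k : ℕ, 1 ≤ k → ∀ A B C D : ℝ, A * C + B * D = 0 →
        IsHarmHomog (2 * k)
          (fun v => (A * ReZ k v + B * ImZ k v) * (C * ReZ k v + D * ImZ k v)) ∧
        ∀ v : ℝ × ℝ,
          ((A * ReZ k v + B * ImZ k v) * (C * ReZ k v + D * ImZ k v)) * 1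
            = (A * ReZ k v + B * ImZ k v) * (C * ReZ k v + D * ImZ k v))) := by
  refine ⟨?_, fun p11 p12 p21 p22 h1 h2 v => by rw [h1, h2], fun k _ A B C D h => ⟨?_, ?_⟩⟩
  · rintro p11 p12 p21 p22 ⟨m, hm⟩ ⟨r, hr⟩ ⟨s, hs⟩ ⟨n, hn⟩ h11 h12 h21 h22 h
    obtain ⟨a, ham, rfl⟩ := hm.exists_eq_reMonomial
    obtain ⟨c, hcr, rfl⟩ := hr.exists_eq_reMonomial
    obtain ⟨d, hds, rfl⟩ := hs.exists_eq_reMonomial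
    obtain ⟨b, hbn, rfl⟩ := hn.exists_eq_reMonomial
    have hne {w : ℂ} {j : ℕ} (hw : reMonomial w j ≠ 0) : w ≠ 0 := by
      rintro rfl
      exact hw (reMonomial_zero_left j)
    exact classified_of_mul_eq (hne h11) (hne h22) (hne h12) (hne h21) ham hbn hcr hds h
  · simp_rw [mul_ReZ_add_mul_ImZ]
    rw [funext (reMonomial_mul_reMonomial (A - B * I) (C - D * I) k (by simpa using h))]
    exact isHarmHomog_reMonomial _ _
  · exact fun v => mul_one _
end
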